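/- arXiv:1101.1946 — 6 statements merged into one kernel-verified Lean document; each statement's English description precedes it below -/
import Mathlib

section
/- Let p be an odd prime and let x be any p-adic integer. Then the following three sums are congruent modulo p² (as elements of the ring ℤ_p of p-adic integers): ∑_{k=0}^{p-1} (-1)^k A_k(x) ≡ ∑_{k=0}^{p-1} (-1)^k W_k(-x) ≡ ∑_{k=0}^{p-1} (C(2k,k)³/16^k) x^k (mod p²). -/
/-- The Apéry polynomial `A_n(x) = ∑_{k=0}^n C(n,k)² C(n+k,k)² x^k`. -/
noncomputable def aperyPoly {R : Type*} [CommRing R] (n : ℕ) (x : R) : R :=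
  ∑ k ∈ Finset.range (n + 1), (n.choose k : R) ^ 2 * ((n + k).choose k : R) ^ 2 * x ^ k

/-- The polynomial `W_n(x) = ∑_{k=0}^n C(n,k)² C(n-k,k)² x^k`. -/
noncomputable def wPoly {R : Type*} [CommRing R] (n : ℕ) (x : R) : R :=
  ∑ k ∈ Finset.range (n + 1), (n.choose k : R) ^ 2 * ((n - k).choose k : R) ^ 2 * x ^ k

/-- Telescoping certificate behind the recurrence in `k` for `∑ n, (-1) ^ n * C(n+k,2k) ^ 2`. -/
theorem choose_sq_telescope (n k : ℕ) :
    8 * ((k : ℤ) + 1) ^ 2 * ((n + (k + 1)).choose (2 * (k + 1)) : ℤ) ^ 2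
        - (2 * k + 1) * (k + 1) * ((n + k).choose (2 * k) : ℤ) ^ 2 =
      ((n + k).choose (2 * k + 1) : ℤ) ^ 2 * ((n : ℤ) ^ 2 - (3 * k + 2) * (k + 1)) +
        ((n + 1 + k).choose (2 * k + 1) : ℤ) ^ 2 *
          (((n + 1 : ℕ) : ℤ) ^ 2 - (3 * k + 2) * (k + 1)) := by
  have h1 : ((n + k).choose (2 * k + 1) : ℚ) * (2 * k + 1) =
      (n + k).choose (2 * k) * (n - k) := by
    rcases lt_or_ge n k with h | h
    · rw [Nat.choose_eq_zero_of_lt (show n + k < 2 * k + 1 by lia),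
        Nat.choose_eq_zero_of_lt (show n + k < 2 * k by lia)]
      simp
    · have := Nat.choose_succ_right_eq (n + k) (2 * k)
      rw [show n + k - 2 * k = n - k by lia] at this
      rw [← Nat.cast_sub h]
      exact_mod_cast this
  have h2 : ((n + 1 + k).choose (2 * k + 1) : ℚ) * (2 * k + 1) =
      (n + k).choose (2 * k) * (n + k + 1) := by
    have := Nat.add_one_mul_choose_eq (n + k) (2 * k)
    rw [show n + 1 + k = n + k + 1 by lia, mul_comm ((n + k).choose (2 * k) : ℚ)]
    exact_mod_cast this.symm
  have h3 : ((n + (k + 1)).choose (2 * (k + 1)) : ℚ) * (2 * k + 2) =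
      (n + k).choose (2 * k + 1) * (n + k + 1) := by
    have := Nat.add_one_mul_choose_eq (n + k) (2 * k + 1)
    rw [show n + (k + 1) = n + k + 1 by lia, mul_comm ((n + k).choose (2 * k + 1) : ℚ),
      show 2 * (k + 1) = 2 * k + 1 + 1 by lia]
    exact_mod_cast this.symm
  have e1 : (2 * k + 1 : ℚ) ≠ 0 := by positivity
  have e2 : (2 * k + 2 : ℚ) ≠ 0 := by positivity
  have e3 : (k + 1 : ℚ) ≠ 0 := by positivity
  rw [← eq_div_iff e1] at h1 h2
  rw [← eq_div_iff e2, h1] at h3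
  suffices h : 8 * ((k : ℚ) + 1) ^ 2 * ((n + (k + 1)).choose (2 * (k + 1)) : ℚ) ^ 2
        - (2 * k + 1) * (k + 1) * ((n + k).choose (2 * k) : ℚ) ^ 2 =
      ((n + k).choose (2 * k + 1) : ℚ) ^ 2 * ((n : ℚ) ^ 2 - (3 * k + 2) * (k + 1)) +
        ((n + 1 + k).choose (2 * k + 1) : ℚ) ^ 2 *
          (((n + 1 : ℕ) : ℚ) ^ 2 - (3 * k + 2) * (k + 1)) by
    exact_mod_cast h
  rw [h1, h2, h3]
  push_cast
  rw [show (2 * k + 2 : ℚ) = 2 * (k + 1) by ring]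
  field_simp
  ring

theorem sum_range_neg_one_pow_mul_add_succ (H : ℕ → ℤ) (N : ℕ) :
    ∑ n ∈ Finset.range N, (-1) ^ n * (H n + H (n + 1)) = H 0 - (-1) ^ N * H N := by
  induction N with
  | zero => simp
  | succ N ih => rw [Finset.sum_range_succ, ih]; ring

theorem prime_dvd_choose_of_le_of_lt_add {p a b : ℕ} (hp : p.Prime) (hb : b < p) (ha : p ≤ a)
    (hab : a < p + b) : p ∣ a.choose b := by
  have := hp.dvd_choose_add (a := b) (b := a - b) hb (by lia) (by lia)
  rwa [show b + (a - b) = a by lia] at this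

theorem isCoprime_prime_sq_add_one {p k : ℕ} (hp : p.Prime) (hk : k + 1 < p) :
    IsCoprime ((p : ℤ) ^ 2) ((k : ℤ) + 1) := by
  apply IsCoprime.pow_left
  exact_mod_cast Nat.isCoprime_iff_coprime.2 (Nat.coprime_of_lt_prime k.succ_ne_zero hk hp)

theorem sum_neg_one_pow_choose_sq_succ {p k : ℕ} (hp : p.Prime) (hk : 2 * k + 1 < p) :
    (p : ℤ) ^ 2 ∣
      8 * (k + 1) * ∑ n ∈ Finset.range p,
          (-1) ^ n * ((n + (k + 1)).choose (2 * (k + 1)) : ℤ) ^ 2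
        - (2 * k + 1) * ∑ n ∈ Finset.range p, (-1) ^ n * ((n + k).choose (2 * k) : ℤ) ^ 2 := by
  have hpk : IsCoprime ((p : ℤ) ^ 2) ((k : ℤ) + 1) := isCoprime_prime_sq_add_one hp (by lia)
  apply hpk.dvd_of_dvd_mul_left
  have ht := sum_range_neg_one_pow_mul_add_succ
    (fun n ↦ ((n + k).choose (2 * k + 1) : ℤ) ^ 2 * ((n : ℤ) ^ 2 - (3 * k + 2) * (k + 1))) p
  have hd : (p : ℤ) ^ 2 ∣ ((p + k).choose (2 * k + 1) : ℤ) ^ 2 :=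
    pow_dvd_pow_of_dvd (Int.natCast_dvd_natCast.2
      (prime_dvd_choose_of_le_of_lt_add hp hk (by lia) (by lia))) 2
  simp only [← choose_sq_telescope, Nat.choose_eq_zero_of_lt (show 0 + k < 2 * k + 1 by lia)] at ht
  convert (((hd.mul_right ((p : ℤ) ^ 2 - (3 * k + 2) * (k + 1))).mul_left ((-1) ^ p)).neg_right)
    using 1
  refine Eq.trans ?_ (ht.trans (by push_cast; ring))
  simp only [mul_sub, ← mul_assoc, Finset.mul_sum,
    ← Finset.sum_sub_distrib]
  exact Finset.sum_congr rfl fun n _ ↦ by ring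

theorem sum_neg_one_pow_choose_sq_congr {p k : ℕ} (hp : p.Prime) (hp2 : p ≠ 2) (hk : 2 * k < p) :
    (p : ℤ) ^ 2 ∣
      16 ^ k * ∑ n ∈ Finset.range p, (-1) ^ n * ((n + k).choose (2 * k) : ℤ) ^ 2
        - ((2 * k).choose k : ℤ) := by
  induction k with
  | zero =>
    have := hp.odd_of_ne_two hp2
    simp [neg_one_geom_sum, Nat.not_even_iff_odd.2 this]
  | succ k ih =>
    have hpk : IsCoprime ((p : ℤ) ^ 2) ((k : ℤ) + 1) := isCoprime_prime_sq_add_one hp (by lia)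
    have hc : ((k : ℤ) + 1) * ((2 * (k + 1)).choose (k + 1) : ℤ) =
        2 * (2 * k + 1) * ((2 * k).choose k : ℤ) := by
      exact_mod_cast Nat.succ_mul_centralBinom_succ k
    apply hpk.dvd_of_dvd_mul_left
    convert ((sum_neg_one_pow_choose_sq_succ hp (k := k) (by lia)).mul_left (2 * 16 ^ k)).add
      ((ih (by lia)).mul_left (2 * (2 * k + 1))) using 1
    rw [mul_sub, hc]
    ring

theorem sum_neg_one_pow_choose_two_mul_sq_congr {p k : ℕ} (hp : p.Prime) (hk : 2 * k < p) :
    (p : ℤ) ^ 2 ∣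
      ∑ n ∈ Finset.range p, (-1) ^ n * ((n + k).choose (2 * k) : ℤ) ^ 2
        - ∑ n ∈ Finset.range p, (-1) ^ (n + k) * (n.choose (2 * k) : ℤ) ^ 2 := by
  obtain ⟨m, rfl⟩ : ∃ m, p = k + m := ⟨p - k, by lia⟩
  have hT : ∑ n ∈ Finset.range (k + m), (-1 : ℤ) ^ (n + k) * (n.choose (2 * k) : ℤ) ^ 2 =
      ∑ n ∈ Finset.range m, (-1) ^ n * ((n + k).choose (2 * k) : ℤ) ^ 2 := by
    rw [Finset.sum_range_add, Finset.sum_eq_zero (s := Finset.range k), zero_add]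
    · refine Finset.sum_congr rfl fun n _ ↦ ?_
      rw [show k + n + k = n + 2 * k by lia, pow_add, pow_mul, add_comm k n]
      simp
    · intro n hn
      rw [Finset.mem_range] at hn
      rw [Nat.choose_eq_zero_of_lt (show n < 2 * k by lia)]
      simp
  rw [hT, add_comm k m, Finset.sum_range_add, add_sub_cancel_left]
  refine Finset.dvd_sum fun n hn ↦ Dvd.dvd.mul_left (pow_dvd_pow_of_dvd
    (Int.natCast_dvd_natCast.2 ?_) 2) _
  rw [Finset.mem_range] at hn
  exact prime_dvd_choose_of_le_of_lt_add (add_comm k m ▸ hp) (by lia) (by lia) (by lia)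

theorem sq_dvd_centralBinom_sq {p k : ℕ} (hp : p.Prime) (hk : k < p) (h : p ≤ 2 * k) :
    (p : ℤ) ^ 2 ∣ ((2 * k).choose k : ℤ) ^ 2 :=
  pow_dvd_pow_of_dvd (Int.natCast_dvd_natCast.2
    (prime_dvd_choose_of_le_of_lt_add hp hk h (by lia))) 2

theorem choose_sq_mul_add_choose_sq {R : Type*} [CommRing R] (n k : ℕ) :
    (n.choose k : R) ^ 2 * ((n + k).choose k : R) ^ 2 =
      ((2 * k).choose k : R) ^ 2 * ((n + k).choose (2 * k) : R) ^ 2 := by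
  have h := Nat.choose_mul (n := n + k) (k := 2 * k) (s := k) (by lia)
  rw [show n + k - k = n by lia, show 2 * k - k = k by lia] at h
  rw [← mul_pow, ← mul_pow, mul_comm, mul_comm ((2 * k).choose k : R)]
  exact_mod_cast congrArg (fun t : ℕ ↦ ((t ^ 2 : ℕ) : R)) h.symm

theorem choose_sq_mul_sub_choose_sq {R : Type*} [CommRing R] (n k : ℕ) :
    (n.choose k : R) ^ 2 * ((n - k).choose k : R) ^ 2 =
      ((2 * k).choose k : R) ^ 2 * (n.choose (2 * k) : R) ^ 2 := by
  have h := Nat.choose_mul (n := n) (k := 2 * k) (s := k) (by lia)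
  rw [show 2 * k - k = k by lia] at h
  rw [← mul_pow, ← mul_pow, mul_comm ((2 * k).choose k : R)]
  exact_mod_cast congrArg (fun t : ℕ ↦ ((t ^ 2 : ℕ) : R)) h.symm

theorem sum_neg_one_pow_mul_sum_choose {R : Type*} [CommRing R] (p : ℕ) (f : ℕ → ℕ → R) :
    ∑ n ∈ Finset.range p, (-1) ^ n *
        ∑ k ∈ Finset.range (n + 1), (n.choose k : R) ^ 2 * f n k =
      ∑ k ∈ Finset.range p, ∑ n ∈ Finset.range p, (-1) ^ n * ((n.choose k : R) ^ 2 * f n k) := by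
  rw [Finset.sum_comm]
  refine Finset.sum_congr rfl fun n hn ↦ ?_
  rw [← Finset.mul_sum]
  congr 1
  refine Finset.sum_subset (fun k hk ↦ ?_) fun k _ hk ↦ ?_
  · simp only [Finset.mem_range] at *; lia
  · rw [Finset.mem_range] at hk
    simp [Nat.choose_eq_zero_of_lt (show n < k by lia)]

theorem sum_neg_one_pow_mul_aperyPoly {R : Type*} [CommRing R] (p : ℕ) (x : R) :
    ∑ n ∈ Finset.range p, (-1) ^ n * aperyPoly n x =
      ∑ k ∈ Finset.range p, ((((2 * k).choose k : ℤ) ^ 2 * ∑ n ∈ Finset.range p,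
        (-1) ^ n * ((n + k).choose (2 * k) : ℤ) ^ 2 : ℤ) : R) * x ^ k := by
  simp only [aperyPoly, mul_assoc]
  rw [sum_neg_one_pow_mul_sum_choose]
  refine Finset.sum_congr rfl fun k _ ↦ ?_
  push_cast
  rw [Finset.mul_sum, Finset.sum_mul]
  refine Finset.sum_congr rfl fun n _ ↦ ?_
  rw [← mul_assoc ((n.choose k : R) ^ 2), choose_sq_mul_add_choose_sq]
  ring

theorem sum_neg_one_pow_mul_wPoly_neg {R : Type*} [CommRing R] (p : ℕ) (x : R) :
    ∑ n ∈ Finset.range p, (-1) ^ n * wPoly n (-x) =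
      ∑ k ∈ Finset.range p, ((((2 * k).choose k : ℤ) ^ 2 * ∑ n ∈ Finset.range p,
        (-1) ^ (n + k) * (n.choose (2 * k) : ℤ) ^ 2 : ℤ) : R) * x ^ k := by
  simp only [wPoly, mul_assoc]
  rw [sum_neg_one_pow_mul_sum_choose]
  refine Finset.sum_congr rfl fun k _ ↦ ?_
  push_cast
  rw [Finset.mul_sum, Finset.sum_mul]
  refine Finset.sum_congr rfl fun n _ ↦ ?_
  rw [← mul_assoc ((n.choose k : R) ^ 2), choose_sq_mul_sub_choose_sq, neg_pow x, pow_add]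
  ring

theorem apery_coeff_congr_w_coeff {p k : ℕ} (hp : p.Prime) (hk : k < p) :
    (p : ℤ) ^ 2 ∣
      ((2 * k).choose k : ℤ) ^ 2 *
          ∑ n ∈ Finset.range p, (-1) ^ n * ((n + k).choose (2 * k) : ℤ) ^ 2
        - ((2 * k).choose k : ℤ) ^ 2 *
          ∑ n ∈ Finset.range p, (-1) ^ (n + k) * (n.choose (2 * k) : ℤ) ^ 2 := by
  rw [← mul_sub]
  rcases lt_or_ge (2 * k) p with h | h
  · exact (sum_neg_one_pow_choose_two_mul_sq_congr hp h).mul_left _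
  · exact (sq_dvd_centralBinom_sq hp hk h).mul_right _

theorem w_coeff_congr_choose_cube {p k : ℕ} (hp : p.Prime) (hp2 : p ≠ 2) (hk : k < p) :
    (p : ℤ) ^ 2 ∣
      16 ^ k * (((2 * k).choose k : ℤ) ^ 2 *
          ∑ n ∈ Finset.range p, (-1) ^ (n + k) * (n.choose (2 * k) : ℤ) ^ 2)
        - ((2 * k).choose k : ℤ) ^ 3 := by
  rcases lt_or_ge (2 * k) p with h | h
  · refine (dvd_sub ((sum_neg_one_pow_choose_sq_congr hp hp2 h).mul_left
      (((2 * k).choose k : ℤ) ^ 2))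
        ((apery_coeff_congr_w_coeff hp hk).mul_left (16 ^ k))).trans (dvd_of_eq ?_)
    ring
  · have := sq_dvd_centralBinom_sq hp hk h
    rw [mul_left_comm, pow_succ _ 2, ← mul_sub]
    exact this.mul_right _

/-- For an odd prime `p` and any `x ∈ ℤ_p`,
`∑_{k=0}^{p-1} (-1)^k A_k(x) ≡ ∑_{k=0}^{p-1} (-1)^k W_k(-x)
  ≡ ∑_{k=0}^{p-1} (C(2k,k)³/16^k) x^k (mod p²)` in `ℤ_p`. -/
theorem sum_apery_neg_one_pow_congr (p : ℕ) [Fact p.Prime] (hp2 : p ≠ 2) (x : ℤ_[p]) :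
    (∃ z : ℤ_[p],
      (∑ k ∈ Finset.range p, (-1 : ℚ_[p]) ^ k * aperyPoly k (x : ℚ_[p])) -
        (∑ k ∈ Finset.range p, (-1 : ℚ_[p]) ^ k * wPoly k (-(x : ℚ_[p]))) =
      (p : ℚ_[p]) ^ 2 * z) ∧
    (∃ z : ℤ_[p],
      (∑ k ∈ Finset.range p, (-1 : ℚ_[p]) ^ k * wPoly k (-(x : ℚ_[p]))) -
        (∑ k ∈ Finset.range p, ((2 * k).choose k : ℚ_[p]) ^ 3 / 16 ^ k * (x : ℚ_[p]) ^ k) =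
      (p : ℚ_[p]) ^ 2 * z) := by
  have hp : p.Prime := Fact.out
  obtain ⟨u, hu⟩ : ∃ u : ℤ_[p], 16 * u = 1 := by
    have h16 : IsUnit (16 : ℤ_[p]) := by
      have : IsUnit ((16 : ℕ) : ℤ_[p]) := by
        rw [PadicInt.isUnit_iff, PadicInt.norm_natCast_eq_one_iff]
        exact ((Nat.coprime_primes hp Nat.prime_two).2 hp2).pow_right 4
      exact_mod_cast this
    exact h16.exists_right_inv
  have hu' : (16 : ℚ_[p]) * u = 1 := by exact_mod_cast congrArg (fun t : ℤ_[p] ↦ (t : ℚ_[p])) hu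
  have hu_inv : (u : ℚ_[p]) = 16⁻¹ := eq_inv_of_mul_eq_one_right hu'
  rw [sum_neg_one_pow_mul_aperyPoly, sum_neg_one_pow_mul_wPoly_neg]
  choose! d hd using fun k (hk : k < p) ↦ apery_coeff_congr_w_coeff hp hk
  choose! e he using fun k (hk : k < p) ↦ w_coeff_congr_choose_cube hp hp2 hk
  constructor
  · refine ⟨∑ k ∈ Finset.range p, (d k : ℤ_[p]) * x ^ k, ?_⟩
    rw [← Finset.sum_sub_distrib, PadicInt.coe_sum, Finset.mul_sum]
    refine Finset.sum_congr rfl fun k hk ↦ ?_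
    rw [← sub_mul, ← Int.cast_sub, hd k (Finset.mem_range.1 hk)]
    push_cast
    ring
  · refine ⟨∑ k ∈ Finset.range p, (e k : ℤ_[p]) * u ^ k * x ^ k, ?_⟩
    rw [← Finset.sum_sub_distrib, PadicInt.coe_sum, Finset.mul_sum]
    refine Finset.sum_congr rfl fun k hk ↦ ?_
    have h := congrArg (fun t : ℤ ↦ (t : ℚ_[p])) (he k (Finset.mem_range.1 hk))
    have h16 : (16 : ℚ_[p]) ^ k ≠ 0 := pow_ne_zero k (by norm_num)
    rw [← sub_mul]
    push_cast at h ⊢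
    rw [hu_inv, inv_pow]
    field_simp
    linear_combination (x : ℚ_[p]) ^ k * h
end

section
/- Let p be an odd prime and let x be a p-adic integer with x ≢ 0 (mod p). Then ∑_{k=0}^{p-1} A_k(x) ≡ ∑_{k=0}^{p-1} W_k(x) (mod p²), where the congruence is in the ring ℤ_p of p-adic integers. -/
/-- The sum of `(C(m,k) C(m-k,k))²` over `k ≤ m < p + k` splits at `m = p`. -/
theorem sum_sq_choose_mul_choose_add (p k : ℕ) :
    ∑ n ∈ Finset.range p, n.choose k ^ 2 * (n + k).choose k ^ 2 =
      ∑ n ∈ Finset.range p, n.choose k ^ 2 * (n - k).choose k ^ 2 +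
      ∑ j ∈ Finset.range k, (p + j).choose k ^ 2 * (p + j - k).choose k ^ 2 := by
  rw [← Finset.sum_range_add (fun m ↦ m.choose k ^ 2 * (m - k).choose k ^ 2), add_comm p k,
    Finset.sum_range_add, Finset.sum_eq_zero (s := Finset.range k), zero_add]
  · refine Finset.sum_congr rfl fun n _ ↦ ?_
    rw [Nat.add_sub_cancel_left, add_comm k n, mul_comm]
  · intro m hm
    simp [Nat.choose_eq_zero_of_lt (Finset.mem_range.mp hm)]

/-- A sum weighted by `C(n,k)²` may be extended from `k ≤ n` to `k < p`. -/
theorem sum_range_choose_mul_extend {R : Type*} [CommRing R] {n p : ℕ} (hn : n < p)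
    (g : ℕ → R) :
    ∑ k ∈ Finset.range (n + 1), (n.choose k : R) ^ 2 * g k =
      ∑ k ∈ Finset.range p, (n.choose k : R) ^ 2 * g k := by
  refine Finset.sum_subset (Finset.range_subset_range.mpr hn) fun k _ hk ↦ ?_
  rw [Nat.choose_eq_zero_of_lt (by simpa using hk)]
  simp

/-- The sum over `n < p` of `∑_{k ≤ n} C(n,k)² b(n,k)² x^k`, ordered by powers of `x`. -/
theorem sum_sum_choose_mul_pow {R : Type*} [CommRing R] (p : ℕ) (b : ℕ → ℕ → ℕ) (x : R) :
    ∑ n ∈ Finset.range p, ∑ k ∈ Finset.range (n + 1),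
        (n.choose k : R) ^ 2 * (b n k : R) ^ 2 * x ^ k =
      ∑ k ∈ Finset.range p,
        ((∑ n ∈ Finset.range p, n.choose k ^ 2 * b n k ^ 2 : ℕ) : R) * x ^ k := by
  simp_rw [mul_assoc]
  rw [Finset.sum_congr rfl fun n hn ↦ sum_range_choose_mul_extend (Finset.mem_range.mp hn)
    fun k ↦ (b n k : R) ^ 2 * x ^ k, Finset.sum_comm]
  refine Finset.sum_congr rfl fun k _ ↦ ?_
  push_cast
  simp_rw [Finset.sum_mul, mul_assoc]

/-- For an odd prime `p` and `x ∈ ℤ_p` with `x ≢ 0 (mod p)`,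
`∑_{k=0}^{p-1} A_k(x) ≡ ∑_{k=0}^{p-1} W_k(x) (mod p²)` in `ℤ_p`. -/
theorem sum_apery_congr_sum_w (p : ℕ) [Fact p.Prime] (hp2 : p ≠ 2) (x : ℤ_[p])
    (hx : ¬ (p : ℤ_[p]) ∣ x) :
    (p : ℤ_[p]) ^ 2 ∣
      (∑ k ∈ Finset.range p, aperyPoly k x) - (∑ k ∈ Finset.range p, wPoly k x) := by
  have hp : p.Prime := Fact.out
  simp only [aperyPoly, wPoly]
  rw [sum_sum_choose_mul_pow p (fun n k ↦ (n + k).choose k),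
    sum_sum_choose_mul_pow p (fun n k ↦ (n - k).choose k), ← Finset.sum_sub_distrib]
  refine Finset.dvd_sum fun k hk ↦ ?_
  rw [sum_sq_choose_mul_choose_add, Nat.cast_add, ← sub_mul, add_sub_cancel_left]
  refine Dvd.dvd.mul_right ?_ _
  rw [← Nat.cast_pow]
  refine Nat.cast_dvd_cast (Finset.dvd_sum fun j hj ↦ Dvd.dvd.mul_right (pow_dvd_pow_of_dvd ?_ 2) _)
  rw [Finset.mem_range] at hk hj
  exact hp.dvd_choose hk (by lia) (by lia)
end

section
/- Let p be an odd prime and let x be an integer not divisible by p. Then ∑_{k=0}^{p-1} A_k(x) ≡ (x/p) · ∑_{k=0}^{p-1} C(4k; k,k,k,k)/(256x)^k (mod p), where (x/p) is the Legendre symbol and the sum on the right is taken in ℤ_p (both 256 and x being invertible modulo p). -/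
open Finset

/-- If `p = 2h + 1` is prime and `k < p` then `C(2k,k) ≡ (-4)^k C(h,k) (mod p)`. -/
theorem centralBinom_eq_neg_four_pow_mul_choose {p h : ℕ} [Fact p.Prime] (hp : p = 2 * h + 1) :
    ∀ k < p, (k.centralBinom : ZMod p) = (-4) ^ k * (h.choose k : ZMod p) := by
  have hph : (2 * h + 1 : ZMod p) = 0 := by
    exact_mod_cast (congrArg (Nat.cast (R := ZMod p)) hp).symm.trans (ZMod.natCast_self p)
  intro k
  induction k with
  | zero => simp
  | succ k ih =>
    intro hk
    have hk0 : ((k + 1 : ℕ) : ZMod p) ≠ 0 := by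
      rw [Ne, ZMod.natCast_eq_zero_iff]
      exact Nat.not_dvd_of_pos_of_lt k.succ_pos hk
    refine mul_left_cancel₀ hk0 ?_
    have e1 : ((k + 1 : ℕ) : ZMod p) * ((k + 1).centralBinom : ZMod p)
        = 2 * (2 * k + 1) * (k.centralBinom : ZMod p) := by
      exact_mod_cast congrArg (Nat.cast (R := ZMod p)) (Nat.succ_mul_centralBinom_succ k)
    have e2 : (h.choose (k + 1) : ZMod p) * ((k + 1 : ℕ) : ZMod p)
        = (h.choose k : ZMod p) * ((h : ZMod p) - k) := by
      rcases le_or_gt k h with hkh | hkh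
      · rw [← Nat.cast_sub hkh]
        exact_mod_cast congrArg (Nat.cast (R := ZMod p)) (Nat.choose_succ_right_eq h k)
      · simp [Nat.choose_eq_zero_of_lt hkh, Nat.choose_eq_zero_of_lt (hkh.trans k.lt_succ_self)]
    rw [e1, ih (by omega)]
    linear_combination (4 * (-4) ^ k) * e2 + 2 * (-4) ^ k * (h.choose k : ZMod p) * hph

/-- For `a + b + 1 = p` prime and `m < p`, `C(m+a,a) ≡ (-1)^m C(b,m) (mod p)`. -/
theorem choose_add_eq_neg_one_pow_mul_choose {p a b : ℕ} [Fact p.Prime] (hab : a + b + 1 = p) :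
    ∀ m < p, ((m + a).choose a : ZMod p) = (-1) ^ m * (b.choose m : ZMod p) := by
  have hpab : (a + b + 1 : ZMod p) = 0 := by
    exact_mod_cast (congrArg (Nat.cast (R := ZMod p)) hab).trans (ZMod.natCast_self p)
  intro m
  induction m with
  | zero => simp
  | succ m ih =>
    intro hm
    have hm0 : ((m + 1 : ℕ) : ZMod p) ≠ 0 := by
      rw [Ne, ZMod.natCast_eq_zero_iff]
      exact Nat.not_dvd_of_pos_of_lt m.succ_pos hm
    refine mul_left_cancel₀ hm0 ?_
    have e1 : ((m + 1 : ℕ) : ZMod p) * ((m + 1 + a).choose a : ZMod p)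
        = ((m + a).choose a : ZMod p) * (m + a + 1) := by
      have h1 := Nat.choose_mul_succ_eq (m + a) a
      rw [show m + a + 1 - a = m + 1 by omega, show m + a + 1 = m + 1 + a by omega] at h1
      have h2 := congrArg (Nat.cast (R := ZMod p)) h1
      push_cast at h2 ⊢
      linear_combination -h2
    have e2 : (b.choose (m + 1) : ZMod p) * ((m + 1 : ℕ) : ZMod p)
        = (b.choose m : ZMod p) * ((b : ZMod p) - m) := by
      rcases le_or_gt m b with hmb | hmb
      · rw [← Nat.cast_sub hmb]
        exact_mod_cast congrArg (Nat.cast (R := ZMod p)) (Nat.choose_succ_right_eq b m)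
      · simp [Nat.choose_eq_zero_of_lt hmb, Nat.choose_eq_zero_of_lt (hmb.trans m.lt_succ_self)]
    rw [e1, ih (by omega)]
    linear_combination (-1) ^ m * e2 + (-1) ^ m * (b.choose m : ZMod p) * hpab

/-- If `p = 2(k + j) + 1` is prime then `∑_{n<p} C(n+k,2k)² ≡ C(4j,2j) (mod p)`. -/
theorem sum_choose_add_two_mul_sq {p k j : ℕ} [Fact p.Prime] (hp : p = 2 * (k + j) + 1) :
    ∑ n ∈ range p, ((n + k).choose (2 * k) : ZMod p) ^ 2 = ((2 * j).centralBinom : ZMod p) := by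
  have hsplit : p = k + (2 * j + 1 + k) := by omega
  have key : ∀ m < p, ((k + m + k).choose (2 * k) : ZMod p) ^ 2
      = (((2 * j).choose m ^ 2 : ℕ) : ZMod p) := by
    intro m hm
    rw [show k + m + k = m + 2 * k by omega,
      choose_add_eq_neg_one_pow_mul_choose (b := 2 * j) (by omega) m hm, mul_pow, ← pow_mul,
      mul_comm m 2, pow_mul]
    simp
  have hlow : ∑ n ∈ range k, ((n + k).choose (2 * k) : ZMod p) ^ 2 = 0 := by
    refine sum_eq_zero fun n hn => ?_
    rw [Nat.choose_eq_zero_of_lt (by have := mem_range.1 hn; omega)]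
    simp
  have hhigh : ∑ m ∈ range (2 * j + 1 + k), ((k + m + k).choose (2 * k) : ZMod p) ^ 2
      = ((2 * j).centralBinom : ZMod p) := by
    rw [sum_congr rfl fun m hm => key m (by have := mem_range.1 hm; omega), sum_range_add,
      ← Nat.cast_sum, Nat.sum_range_choose_sq, Nat.centralBinom_eq_two_mul_choose]
    simp [Nat.choose_eq_zero_of_lt, add_assoc]
  rw [show range p = range (k + (2 * j + 1 + k)) from congrArg range hsplit, sum_range_add,
    hlow, hhigh, zero_add]

/-- `C(n,k) C(n+k,k) = C(2k,k) C(n+k,2k)`. -/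
theorem choose_mul_choose_add_eq (n k : ℕ) :
    n.choose k * (n + k).choose k = k.centralBinom * (n + k).choose (2 * k) := by
  have h := Nat.choose_mul (n := n + k) (k := 2 * k) (s := k) (by omega)
  rw [show n + k - k = n by omega, show 2 * k - k = k by omega] at h
  rw [Nat.centralBinom_eq_two_mul_choose, mul_comm, ← h, mul_comm]

/-- The sum of Apéry polynomials, in terms of central binomial coefficients. -/
theorem sum_aperyPoly_eq {R : Type*} [CommRing R] (N : ℕ) (x : R) :
    ∑ n ∈ range N, aperyPoly n x = ∑ k ∈ range N, (k.centralBinom : R) ^ 2 * x ^ k *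
      ∑ n ∈ range N, ((n + k).choose (2 * k) : R) ^ 2 := by
  have h : ∀ n ∈ range N, aperyPoly n x = ∑ k ∈ range N,
      (k.centralBinom : R) ^ 2 * x ^ k * ((n + k).choose (2 * k) : R) ^ 2 := by
    intro n hn
    have hterm : ∀ k, (n.choose k : R) ^ 2 * ((n + k).choose k : R) ^ 2 * x ^ k
        = (k.centralBinom : R) ^ 2 * x ^ k * ((n + k).choose (2 * k) : R) ^ 2 := by
      intro k
      have e := congrArg (Nat.cast (R := R)) (choose_mul_choose_add_eq n k)
      push_cast at e
      rw [← mul_pow, e]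
      ring
    simp only [aperyPoly, ← hterm]
    refine sum_subset (range_subset_range.2 (mem_range.1 hn)) fun k _ hk => ?_
    rw [Nat.choose_eq_zero_of_lt (by simpa using hk)]
    simp
  rw [sum_congr rfl h, sum_comm]
  simp only [mul_sum]

/-- `(4k)!/(k!)⁴ = C(4k,2k) C(2k,k)²`. -/
theorem factorial_four_mul_div (k : ℕ) :
    (4 * k).factorial / k.factorial ^ 4 = (2 * k).centralBinom * k.centralBinom ^ 2 := by
  have h1 := Nat.add_choose_mul_factorial_mul_factorial k k
  have h2 := Nat.add_choose_mul_factorial_mul_factorial (2 * k) (2 * k)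
  rw [← two_mul, ← Nat.centralBinom_eq_two_mul_choose] at h1 h2
  refine Nat.div_eq_of_eq_mul_left (by positivity) ?_
  rw [show 4 * k = 2 * (2 * k) by ring, ← h2, ← h1]
  ring

/-- The congruence of the main theorem, stated in `ZMod p`. -/
theorem sum_aperyPoly_zmod {p h : ℕ} [Fact p.Prime] (hp : p = 2 * h + 1) {x u : ZMod p}
    (hu : 256 * x * u = 1) :
    ∑ n ∈ range p, aperyPoly n x = x ^ h * ∑ k ∈ range p,
      (((4 * k).factorial / k.factorial ^ 4 : ℕ) : ZMod p) * u ^ k := by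
  have hsub : range (h + 1) ⊆ range p := range_subset_range.2 (by omega)
  have hvan' : ∀ k ∈ range p, k ∉ range (h + 1) → (k.centralBinom : ZMod p) ^ 2 = 0 := by
    intro k hk hk'
    rw [centralBinom_eq_neg_four_pow_mul_choose hp k (mem_range.1 hk),
      Nat.choose_eq_zero_of_lt (by simpa using hk')]
    simp
  have h4 : (4 : ZMod p) ≠ 0 := by
    intro h0
    apply one_ne_zero (α := ZMod p)
    rw [← hu, show (256 : ZMod p) = 4 * 64 by norm_num, h0]
    ring
  have h4p : (4 : ZMod p) ^ (2 * h) = 1 := by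
    have := ZMod.pow_card_sub_one_eq_one h4
    rwa [show p - 1 = 2 * h by omega] at this
  rw [sum_aperyPoly_eq, ← sum_subset hsub fun k hk hk' => by rw [hvan' k hk hk']; ring,
    ← sum_subset hsub fun k hk hk' => by
      rw [factorial_four_mul_div, Nat.cast_mul, Nat.cast_pow, hvan' k hk hk']; ring,
    ← sum_range_reflect, mul_sum]
  refine sum_congr rfl fun j hj => ?_
  obtain ⟨i, rfl⟩ := Nat.exists_eq_add_of_le (Nat.lt_succ_iff.1 (mem_range.1 hj))
  rw [show j + i + 1 - 1 - j = i by omega, sum_choose_add_two_mul_sq (j := j) (by omega),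
    factorial_four_mul_div, Nat.cast_mul, Nat.cast_pow,
    centralBinom_eq_neg_four_pow_mul_choose hp i (by omega),
    centralBinom_eq_neg_four_pow_mul_choose hp j (by omega),
    show (j + i).choose j = (j + i).choose i from Nat.choose_symm_add]
  have hxu : x ^ j * u ^ j * 256 ^ j = 1 := by
    rw [← mul_pow, ← mul_pow, show x * u * 256 = 256 * x * u by ring, hu, one_pow]
  have h16 : (16 : ZMod p) ^ j * 16 ^ i = 1 := by
    rw [← pow_add, ← h4p, pow_mul]
    norm_num
  have hsq : ∀ n : ℕ, ((-4 : ZMod p) ^ n) ^ 2 = 16 ^ n := by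
    intro n
    rw [← pow_mul, mul_comm, pow_mul]
    norm_num
  have h256 : (256 : ZMod p) ^ j = 16 ^ j * 16 ^ j := by
    rw [← mul_pow]
    norm_num
  have hkey : (16 : ZMod p) ^ i = x ^ j * u ^ j * 16 ^ j := by
    rw [h256] at hxu
    linear_combination (-(16 : ZMod p) ^ i) * hxu + x ^ j * u ^ j * 16 ^ j * h16
  simp only [mul_pow, hsq, pow_add]
  rw [hkey]
  ring

/-- For an odd prime `p` and an integer `x` not divisible by `p`,
`∑_{k=0}^{p-1} A_k(x) ≡ (x/p) ∑_{k=0}^{p-1} C(4k;k,k,k,k)/(256x)^k (mod p)` in `ℤ_p`,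
where `C(4k;k,k,k,k) = (4k)!/(k!)⁴` and `(x/p)` is the Legendre symbol. -/
theorem sum_apery_congr_multinomial (p : ℕ) [Fact p.Prime] (hp2 : p ≠ 2) (x : ℤ)
    (hx : ¬ (p : ℤ) ∣ x) :
    ∃ z : ℤ_[p],
      (∑ k ∈ Finset.range p, aperyPoly k (x : ℚ_[p])) -
        (legendreSym p x : ℚ_[p]) *
          ∑ k ∈ Finset.range p,
            (((4 * k).factorial / k.factorial ^ 4 : ℕ) : ℚ_[p]) / (256 * (x : ℚ_[p])) ^ k =
      (p : ℚ_[p]) * z := by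
  have hprime : p.Prime := Fact.out
  have hp : p = 2 * (p / 2) + 1 := by
    have := hprime.eq_two_or_odd
    omega
  have hndvd : ¬ (p : ℤ) ∣ 256 * x := by
    intro hd
    rcases (Nat.prime_iff_prime_int.1 hprime).dvd_or_dvd hd with h | h
    · have h' : p ∣ 2 ^ 8 := by exact_mod_cast h
      exact hp2 ((Nat.prime_dvd_prime_iff_eq hprime Nat.prime_two).1 (hprime.dvd_of_dvd_pow h'))
    · exact hx h
  have hunit : IsUnit (256 * (x : ℤ_[p])) := by
    by_contra hn
    rw [PadicInt.not_isUnit_iff] at hn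
    exact hndvd (PadicInt.norm_int_lt_one_iff_dvd _ |>.1 (by exact_mod_cast hn))
  obtain ⟨u, hu⟩ := hunit.exists_right_inv
  set e : ℤ_[p] := (∑ k ∈ range p, aperyPoly k (x : ℤ_[p])) - (legendreSym p x : ℤ_[p]) *
    ∑ k ∈ range p, (((4 * k).factorial / k.factorial ^ 4 : ℕ) : ℤ_[p]) * u ^ k with he
  have huz : 256 * (x : ZMod p) * PadicInt.toZMod u = 1 := by
    simpa only [map_mul, map_one, map_ofNat, map_intCast] using
      congrArg (PadicInt.toZMod (p := p)) hu
  have hz := sum_aperyPoly_zmod hp huz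
  rw [← legendreSym.eq_pow] at hz
  have he0 : PadicInt.toZMod e = 0 := by
    rw [he, map_sub, sub_eq_zero]
    simpa only [aperyPoly, map_sum, map_mul, map_pow, map_natCast, map_intCast] using hz
  have hmem : e ∈ Ideal.span {(p : ℤ_[p])} := by
    rw [← PadicInt.maximalIdeal_eq_span_p, ← PadicInt.ker_toZMod]
    exact he0
  obtain ⟨z, hz'⟩ := Ideal.mem_span_singleton.1 hmem
  have huQ : 256 * (x : ℚ_[p]) * (u : ℚ_[p]) = 1 := by
    exact_mod_cast congrArg (↑· : ℤ_[p] → ℚ_[p]) hu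
  refine ⟨z, ?_⟩
  have hzQ : (e : ℚ_[p]) = (p : ℚ_[p]) * z := by rw [hz']; push_cast; rfl
  rw [← hzQ, he]
  have hsum : ∀ k : ℕ, (((4 * k).factorial / k.factorial ^ 4 : ℕ) : ℚ_[p]) /
      (256 * (x : ℚ_[p])) ^ k = (((4 * k).factorial / k.factorial ^ 4 : ℕ) : ℚ_[p]) * u ^ k := by
    intro k
    rw [div_eq_mul_inv, ← inv_pow, ← eq_inv_of_mul_eq_one_right huQ]
  simp only [hsum, aperyPoly]
  have hcoe : ∀ a : ℤ_[p], (a : ℚ_[p]) = PadicInt.Coe.ringHom a := fun _ => rfl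
  simp only [hcoe, map_sub, map_sum, map_mul, map_pow, map_natCast, map_intCast]
end

section
/- For any positive integer n and any x (an indeterminate, or equivalently for all integers x) we have the identity ∑_{k=0}^{n-1} (2k+1) A_k(x) = n · ∑_{k=0}^{n-1} C(n-1,k) C(n+k,k) C(n+k,2k+1) C(2k,k) x^k. -/
/-- The Pascal-type recurrence `(m + 1 - k) C(m+1,k) = (m + 1) C(m,k)` over the integers. -/
theorem succ_sub_mul_choose_succ (m k : ℕ) :
    ((m : ℤ) + 1 - k) * ((m + 1).choose k : ℤ) = ((m : ℤ) + 1) * (m.choose k : ℤ) := by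
  rcases le_or_gt k (m + 1) with h | h
  · have h1 := Nat.choose_mul_succ_eq m k
    zify [h] at h1
    linarith
  · rw [Nat.choose_eq_zero_of_lt h, Nat.choose_eq_zero_of_lt (by omega : m < k)]
    simp

/-- The recurrence in `m` for the product `C(m,k) C(m+k,k)`. -/
theorem succ_sub_mul_choose_mul_choose_succ (m k : ℕ) :
    ((m : ℤ) + 1 - k) * (((m + 1).choose k : ℤ) * ((m + 1 + k).choose k : ℤ)) =
      ((m : ℤ) + 1 + k) * ((m.choose k : ℤ) * ((m + k).choose k : ℤ)) := by
  have h1 := succ_sub_mul_choose_succ m k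
  have h2 := succ_sub_mul_choose_succ (m + k) k
  rw [show m + k + 1 = m + 1 + k by ring] at h2
  push_cast at h2
  linear_combination ((m + 1 + k).choose k : ℤ) * h1 + (m.choose k : ℤ) * h2

/-- The closed form of `∑_{m<n} (2m+1) C(m,k)² C(m+k,k)²`, up to the factor `2k+1`. -/
theorem two_mul_add_one_mul_sum_choose_sq (n k : ℕ) :
    (2 * (k : ℤ) + 1) * ∑ m ∈ Finset.range n,
        (2 * (m : ℤ) + 1) * ((m.choose k : ℤ) ^ 2 * ((m + k).choose k : ℤ) ^ 2) =
      (((n : ℤ) - k) * ((n.choose k : ℤ) * ((n + k).choose k : ℤ))) ^ 2 := by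
  induction n with
  | zero => cases k <;> simp
  | succ n ih =>
    rw [Finset.sum_range_succ, mul_add, ih]
    push_cast
    rw [succ_sub_mul_choose_mul_choose_succ]
    ring

/-- `(2k+1) C(n+k,2k+1) C(2k,k) = (n-k) C(n,k) C(n+k,k)` for `k ≤ n`. -/
theorem two_mul_add_one_mul_choose_mul_centralBinom {n k : ℕ} (h : k ≤ n) :
    (2 * (k : ℤ) + 1) * (((n + k).choose (2 * k + 1) : ℤ) * ((2 * k).choose k : ℤ)) =
      ((n : ℤ) - k) * ((n.choose k : ℤ) * ((n + k).choose k : ℤ)) := by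
  have h1 := Nat.choose_succ_right_eq (n + k) (2 * k)
  have h2 := Nat.choose_mul (n := n + k) (k := 2 * k) (s := k) (by omega)
  rw [show n + k - k = n by omega, show 2 * k - k = k by omega] at h2
  rw [show n + k - 2 * k = n - k by omega] at h1
  zify [h] at h1 h2
  linear_combination ((2 * k).choose k : ℤ) * h1 + ((n : ℤ) - k) * h2

/-- The coefficient of `x ^ k` in `∑_{m<n} (2m+1) A_m(x)`. -/
theorem sum_two_mul_add_one_mul_choose_sq {n k : ℕ} (h : k < n) :
    ∑ m ∈ Finset.range n,
        (2 * (m : ℤ) + 1) * ((m.choose k : ℤ) ^ 2 * ((m + k).choose k : ℤ) ^ 2) =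
      (n : ℤ) * (((n - 1).choose k : ℤ) * ((n + k).choose k : ℤ) *
        ((n + k).choose (2 * k + 1) : ℤ) * ((2 * k).choose k : ℤ)) := by
  have h0 : (2 * (k : ℤ) + 1) ≠ 0 := by positivity
  apply mul_left_cancel₀ h0
  rw [two_mul_add_one_mul_sum_choose_sq]
  have h1 := two_mul_add_one_mul_choose_mul_centralBinom h.le
  have h2 := succ_sub_mul_choose_succ (n - 1) k
  rw [show n - 1 + 1 = n by omega, Nat.cast_sub (by omega : 1 ≤ n)] at h2
  push_cast at h2
  linear_combination
    (-(n : ℤ) * ((n - 1).choose k : ℤ) * ((n + k).choose k : ℤ)) * h1 +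
    (((n + k).choose k : ℤ) * (((n : ℤ) - k) * ((n.choose k : ℤ) * ((n + k).choose k : ℤ)))) * h2

/-- The sum defining `A_m(x)` may be extended to any longer range. -/
theorem aperyPoly_eq_sum_range {R : Type*} [CommRing R] {m n : ℕ} (h : m < n) (x : R) :
    aperyPoly m x = ∑ k ∈ Finset.range n,
      (m.choose k : R) ^ 2 * ((m + k).choose k : R) ^ 2 * x ^ k := by
  refine Finset.sum_subset (Finset.range_mono h) fun k _ hk => ?_
  rw [Finset.mem_range, not_lt] at hk
  simp [Nat.choose_eq_zero_of_lt (by omega : m < k)]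

/-- For any positive integer `n` and any integer `x`,
`∑_{k=0}^{n-1} (2k+1) A_k(x)
  = n ∑_{k=0}^{n-1} C(n-1,k) C(n+k,k) C(n+k,2k+1) C(2k,k) x^k`. -/
theorem sum_two_k_add_one_apery (n : ℕ) (hn : 0 < n) (x : ℤ) :
    ∑ k ∈ Finset.range n, (2 * (k : ℤ) + 1) * aperyPoly k x =
      (n : ℤ) * ∑ k ∈ Finset.range n,
        ((n - 1).choose k : ℤ) * ((n + k).choose k : ℤ) *
          ((n + k).choose (2 * k + 1) : ℤ) * ((2 * k).choose k : ℤ) * x ^ k := by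
  calc
    _ = ∑ m ∈ Finset.range n, ∑ k ∈ Finset.range n,
        (2 * (m : ℤ) + 1) * ((m.choose k : ℤ) ^ 2 * ((m + k).choose k : ℤ) ^ 2) * x ^ k := by
      refine Finset.sum_congr rfl fun m hm => ?_
      rw [aperyPoly_eq_sum_range (Finset.mem_range.mp hm), Finset.mul_sum]
      exact Finset.sum_congr rfl fun k _ => by ring
    _ = _ := by
      rw [Finset.sum_comm, Finset.mul_sum]
      refine Finset.sum_congr rfl fun k hk => ?_
      rw [← Finset.sum_mul, sum_two_mul_add_one_mul_choose_sq (Finset.mem_range.mp hk)]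
      ring
end

section
/- Let p > 3 be a prime. Then ∑_{k=0}^{p-1} (2k+1) A_k ≡ p + (7/6) p⁴ B_{p-3} (mod p⁵), i.e., the p-adic valuation of ∑_{k=0}^{p-1} (2k+1) A_k - p - (7/6) p⁴ B_{p-3} (a rational number whose denominator is not divisible by p) is at least 5. -/
/-- The Apéry number `A_n = ∑_{k=0}^n C(n,k)² C(n+k,k)²`. -/
def aperyNum (n : ℕ) : ℤ :=
  ∑ k ∈ Finset.range (n + 1), (n.choose k : ℤ) ^ 2 * ((n + k).choose k : ℤ) ^ 2

section

open Finset
open Polynomial hiding bernoulli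

section Identity

variable {K : Type*} [Field K] [CharZero K]

lemma choose_mul_choose_succ (n k : ℕ) :
    (n.choose (k + 1) * (n + (k + 1)).choose (k + 1) : K) * ((k : K) + 1) ^ 2 =
      n.choose k * (n + k).choose k * (((n : K) - k) * (n + k + 1)) := by
  have h1 : (n.choose (k + 1) : K) * (k + 1) = n.choose k * (n - k) := by
    rcases le_or_gt k n with h | h
    · rw [← Nat.cast_sub h]
      exact_mod_cast Nat.choose_succ_right_eq n k
    · simp [Nat.choose_eq_zero_of_lt h, Nat.choose_eq_zero_of_lt (h.trans k.lt_succ_self)]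
  have h2 : ((n + (k + 1)).choose (k + 1) : K) * (k + 1) = (n + k + 1) * (n + k).choose k := by
    exact_mod_cast (Nat.add_one_mul_choose_eq (n + k) k).symm
  linear_combination ((n + (k + 1)).choose (k + 1) : K) * (k + 1) * h1 +
    (n.choose k : K) * (n - k) * h2

lemma choose_mul_choose_mul_add (n k : ℕ) :
    (n.choose k * (n + k).choose k : K) * (n + k + 1) =
      (n + 1) * ∏ j ∈ range k, (((n : K) + 1) ^ 2 - (j + 1) ^ 2) / (j + 1) ^ 2 := by
  induction k with
  | zero => simp
  | succ k ih =>
    have hk : ((k : K) + 1) ^ 2 ≠ 0 := pow_ne_zero 2 k.cast_add_one_ne_zero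
    rw [prod_range_succ, ← mul_assoc, ← ih, ← mul_div_assoc, eq_div_iff hk]
    have := choose_mul_choose_succ (K := K) n k
    push_cast
    linear_combination ((n : K) + (k + 1) + 1) * this

lemma choose_mul_choose_mul_sub (n k : ℕ) :
    (n.choose k * (n + k).choose k : K) * (n - k) =
      n * ∏ j ∈ range k, ((n : K) ^ 2 - (j + 1) ^ 2) / (j + 1) ^ 2 := by
  induction k with
  | zero => simp
  | succ k ih =>
    have hk : ((k : K) + 1) ^ 2 ≠ 0 := pow_ne_zero 2 k.cast_add_one_ne_zero
    rw [prod_range_succ, ← mul_assoc, ← ih, ← mul_div_assoc, eq_div_iff hk]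
    have := choose_mul_choose_succ (K := K) n k
    push_cast
    linear_combination ((n : K) - (k + 1)) * this

lemma sum_two_mul_add_one_mul_choose_sq_s4 (n k : ℕ) :
    (2 * (k : K) + 1) *
        ∑ l ∈ range n, (2 * (l : K) + 1) * (l.choose k * (l + k).choose k : K) ^ 2 =
      (n : K) ^ 2 * (∏ j ∈ range k, ((n : K) ^ 2 - (j + 1) ^ 2) / (j + 1) ^ 2) ^ 2 := by
  induction n with
  | zero => simp
  | succ n ih =>
    rw [sum_range_succ, mul_add, ih]
    push_cast
    rw [← mul_pow, ← mul_pow, ← choose_mul_choose_mul_add, ← choose_mul_choose_mul_sub]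
    ring

/-- Sun's evaluation of `∑ (2l+1) A_l`. -/
lemma sum_two_mul_add_one_mul_aperyNum (n : ℕ) :
    ((∑ l ∈ range n, (2 * (l : ℤ) + 1) * aperyNum l : ℤ) : K) =
      ∑ k ∈ range n, (n : K) ^ 2 / (2 * k + 1) *
        (∏ j ∈ range k, ((n : K) ^ 2 - (j + 1) ^ 2) / (j + 1) ^ 2) ^ 2 := by
  have hA (l : ℕ) (hl : l ∈ range n) : ((aperyNum l : ℤ) : K) =
      ∑ k ∈ range n, (l.choose k * (l + k).choose k : K) ^ 2 := by
    rw [aperyNum]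
    push_cast
    simp_rw [mul_pow]
    refine sum_subset (range_subset_range.2 (mem_range.1 hl)) fun k _ hk => ?_
    rw [Nat.choose_eq_zero_of_lt (by simpa using hk)]
    simp
  push_cast
  rw [sum_congr rfl fun l hl => by rw [hA l hl, mul_sum], sum_comm]
  refine sum_congr rfl fun k _ => ?_
  have hk : (2 * (k : K) + 1) ≠ 0 := by exact_mod_cast (2 * k).succ_ne_zero
  rw [div_mul_eq_mul_div, eq_div_iff hk, ← sum_two_mul_add_one_mul_choose_sq_s4, mul_comm]

end Identity

section SumSplitting

variable {R : Type*} [CommRing R]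

lemma sum_range_two_mul_add_one_reflect (m : ℕ) (f : ℕ → R) :
    ∑ i ∈ range (2 * m + 1), f i =
      f 0 + ∑ y ∈ range m, (f (y + 1) + f (2 * m + 1 - (y + 1))) := by
  rw [show 2 * m + 1 = (m + 1) + m by ring, sum_range_add, sum_range_succ',
    ← sum_range_reflect (fun y => f (m + 1 + y)), sum_add_distrib, add_comm _ (f 0), add_assoc]
  congr 2
  exact sum_congr rfl fun y hy => congrArg f (by have := mem_range.1 hy; omega)

lemma sum_range_two_mul_add_one_parity (m : ℕ) (f : ℕ → R) :
    ∑ i ∈ range (2 * m + 1), f i =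
      f 0 + ∑ y ∈ range m, (f (2 * (y + 1)) + f (2 * m + 1 - 2 * (y + 1))) := by
  have h : ∑ i ∈ range (2 * m + 1), f i =
      f 0 + ∑ y ∈ range m, (f (2 * (y + 1)) + f (2 * y + 1)) := by
    induction m with
    | zero => simp
    | succ m ih =>
      rw [show 2 * (m + 1) + 1 = 2 * m + 1 + 1 + 1 by ring, sum_range_succ, sum_range_succ, ih,
        sum_range_succ]
      ring_nf
  rw [h, sum_add_distrib, sum_add_distrib, ← sum_range_reflect (fun y => f (2 * y + 1))]
  congr 2
  exact sum_congr rfl fun y hy => congrArg f (by have := mem_range.1 hy; omega)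

lemma sum_range_two_mul_add_one_center (m : ℕ) (f : ℕ → R) :
    ∑ i ∈ range (2 * m + 1), f i =
      f m + ∑ y ∈ range m, (f (m - (y + 1)) + f (m + (y + 1))) := by
  rw [show 2 * m + 1 = m + 1 + m by ring, sum_range_add, sum_range_succ,
    ← sum_range_reflect f, sum_add_distrib, add_comm _ (f m), add_assoc]
  congr 2
  · exact sum_congr rfl fun y hy => congrArg f (by omega)
  · exact sum_congr rfl fun y hy => congrArg f (by omega)

/-- Splitting a sum over `0 < i < p` by reflection and by parity. -/
lemma dvd_sum_range_sub_of_reflect {m : ℕ} {f g : ℕ → R} {a c lam mu : R} (h0 : f 0 = 0)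
    (hr : ∀ i, 0 < i → i < 2 * m + 1 → a ∣ f (2 * m + 1 - i) - (f i + c * g i))
    (hf : ∀ i, f (2 * i) = lam * f i) (hg : ∀ i, g (2 * i) = mu * g i) :
    a ∣ ∑ i ∈ range (2 * m + 1), f i -
        (2 * ∑ y ∈ range m, f (y + 1) + c * ∑ y ∈ range m, g (y + 1)) ∧
      a ∣ ∑ i ∈ range (2 * m + 1), f i -
        (2 * (lam * ∑ y ∈ range m, f (y + 1)) + c * (mu * ∑ y ∈ range m, g (y + 1))) := by
  constructor
  · rw [sum_range_two_mul_add_one_reflect, h0, zero_add]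
    simp_rw [mul_sum]
    rw [← sum_add_distrib, ← sum_sub_distrib]
    refine dvd_sum fun y hy => ?_
    convert hr (y + 1) (by omega) (by have := mem_range.1 hy; omega) using 1
    ring
  · rw [sum_range_two_mul_add_one_parity, h0, zero_add]
    simp_rw [mul_sum]
    rw [← sum_add_distrib, ← sum_sub_distrib]
    refine dvd_sum fun y hy => ?_
    convert hr (2 * (y + 1)) (by omega) (by have := mem_range.1 hy; omega) using 1
    rw [hf, hg]
    ring

end SumSplitting

section Padic

variable {p : ℕ} [hp : Fact p.Prime]

lemma PadicInt.isUnit_natCast_iff {n : ℕ} : IsUnit (n : ℤ_[p]) ↔ ¬ p ∣ n := by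
  rw [PadicInt.isUnit_iff, PadicInt.norm_natCast_eq_one_iff, hp.out.coprime_iff_not_dvd]

lemma PadicInt.isUnit_natCast_of_lt {n : ℕ} (h0 : 0 < n) (hn : n < p) : IsUnit (n : ℤ_[p]) :=
  PadicInt.isUnit_natCast_iff.2 (Nat.not_dvd_of_pos_of_lt h0 hn)

lemma PadicInt.coe_inverse {x : ℤ_[p]} (hx : IsUnit x) :
    ((Ring.inverse x : ℤ_[p]) : ℚ_[p]) = (x : ℚ_[p])⁻¹ := by
  refine eq_inv_of_mul_eq_one_left ?_
  rw [← PadicInt.coe_mul, Ring.inverse_mul_cancel x hx, PadicInt.coe_one]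

lemma PadicInt.toZMod_eq_zero_iff {x : ℤ_[p]} : PadicInt.toZMod x = 0 ↔ (p : ℤ_[p]) ∣ x := by
  rw [← RingHom.mem_ker, PadicInt.ker_toZMod, PadicInt.maximalIdeal_eq_span_p,
    Ideal.mem_span_singleton]

lemma PadicInt.toZMod_inverse (x : ℤ_[p]) :
    PadicInt.toZMod (Ring.inverse x) = (PadicInt.toZMod x)⁻¹ := by
  by_cases hx : IsUnit x
  · refine eq_inv_of_mul_eq_one_left ?_
    rw [← map_mul, Ring.inverse_mul_cancel x hx, map_one]
  · rw [Ring.inverse_non_unit x hx, map_zero]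
    have : PadicInt.toZMod x = 0 := by
      rw [← RingHom.mem_ker, PadicInt.ker_toZMod]
      exact (IsLocalRing.mem_maximalIdeal x).2 hx
    rw [this, inv_zero]

lemma norm_bernoulli_le_one {n : ℕ} (hn : n + 1 < p) : ‖(bernoulli n : ℚ_[p])‖ ≤ 1 := by
  have h' : ∀ n : ℕ, n + 1 < p → ‖(bernoulli' n : ℚ_[p])‖ ≤ 1 := by
    intro n
    induction n using Nat.strong_induction_on with
    | _ n ih =>
      intro hn
      choose! b hb using fun k (hk : k < n) =>
        (⟨⟨_, ih k hk (by omega)⟩, rfl⟩ : ∃ z : ℤ_[p], (z : ℚ_[p]) = (bernoulli' k : ℚ_[p]))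
      have : (bernoulli' n : ℚ_[p]) =
          ((1 - ∑ k ∈ range n, n.choose k * Ring.inverse ((n - k + 1 : ℕ) : ℤ_[p]) * b k :
            ℤ_[p]) : ℚ_[p]) := by
        rw [bernoulli'_def]
        push_cast [PadicInt.coe_sum]
        congr 1
        refine sum_congr rfl fun k hk => ?_
        have hk := mem_range.1 hk
        have hu := PadicInt.isUnit_natCast_of_lt (p := p) (n := n - k + 1) (by omega) (by omega)
        push_cast at hu
        rw [PadicInt.coe_inverse hu, hb k hk]
        push_cast [Nat.cast_sub hk.le]
        rw [div_eq_mul_inv]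
      rw [this]
      exact PadicInt.norm_le_one _
  rw [bernoulli]
  push_cast
  rw [norm_mul, norm_pow, norm_neg, norm_one, one_pow, one_mul]
  exact h' n hn

/-- Faulhaber's polynomial has `p`-integral coefficients for exponents below `p - 1`. -/
lemma exists_faulhaber_polynomial {e : ℕ} (hep : e + 1 < p) :
    ∃ P : ℤ_[p][X], P.natDegree ≤ e + 1 ∧ P.coeff 0 = 0 ∧
      (P.coeff 1 : ℚ_[p]) = (bernoulli e : ℚ_[p]) ∧
      ∀ n : ℕ, P.eval (n : ℤ_[p]) = ∑ i ∈ range n, (i : ℤ_[p]) ^ e := by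
  choose! b hb using fun k (hk : k ≤ e) =>
    (⟨⟨_, norm_bernoulli_le_one (by omega)⟩, rfl⟩ :
      ∃ z : ℤ_[p], (z : ℚ_[p]) = (bernoulli k : ℚ_[p]))
  have hu : IsUnit ((e + 1 : ℕ) : ℤ_[p]) := PadicInt.isUnit_natCast_of_lt e.succ_pos hep
  refine ⟨∑ i ∈ range (e + 1), monomial (e + 1 - i)
    (b i * (e + 1).choose i * Ring.inverse ((e + 1 : ℕ) : ℤ_[p])), ?_, ?_, ?_, ?_⟩
  · exact natDegree_sum_le_of_forall_le _ _ fun i _ =>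
      (natDegree_monomial_le _).trans (Nat.sub_le _ _)
  · rw [finsetSum_coeff]
    refine sum_eq_zero fun i hi => ?_
    rw [coeff_monomial, if_neg (by have := mem_range.1 hi; omega)]
  · rw [finsetSum_coeff, sum_eq_single_of_mem e (by simp)]
    · rw [coeff_monomial, if_pos (by omega), Nat.choose_succ_self_right, mul_assoc,
        Ring.mul_inverse_cancel _ hu, mul_one, hb e le_rfl]
    · intro i hi hie
      rw [coeff_monomial, if_neg (by have := mem_range.1 hi; omega)]
  · intro n
    refine PadicInt.ext ?_
    rw [eval_finsetSum]
    have := congrArg (fun q : ℚ => (q : ℚ_[p])) (sum_range_pow n e)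
    simp only [eval_monomial]
    push_cast [PadicInt.coe_sum] at this ⊢
    rw [this]
    refine sum_congr rfl fun i hi => ?_
    push_cast at hu
    rw [PadicInt.coe_inverse hu, hb i (by have := mem_range.1 hi; omega)]
    push_cast
    ring

lemma faulhaber_comp_add_one {P : ℤ_[p][X]} {e : ℕ}
    (hP : ∀ n : ℕ, P.eval (n : ℤ_[p]) = ∑ i ∈ range n, (i : ℤ_[p]) ^ e) :
    P.comp (X + 1) = P + X ^ e := by
  refine eq_of_infinite_eval_eq _ _ (Set.Infinite.mono ?_
    (Set.infinite_range_of_injective (Nat.cast_injective (R := ℤ_[p]))))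
  rintro _ ⟨n, rfl⟩
  have := hP (n + 1)
  rw [sum_range_succ, ← hP n] at this
  simpa using this

lemma eval_derivative_faulhaber {P : ℤ_[p][X]} {e : ℕ}
    (hP : ∀ n : ℕ, P.eval (n : ℤ_[p]) = ∑ i ∈ range n, (i : ℤ_[p]) ^ e) (n : ℕ) :
    (derivative P).eval (n : ℤ_[p]) =
      P.coeff 1 + e * ∑ i ∈ range n, (i : ℤ_[p]) ^ (e - 1) := by
  induction n with
  | zero => simp [← coeff_zero_eq_eval_zero, coeff_derivative]
  | succ n ih =>
    have := congrArg (fun Q => (derivative Q).eval (n : ℤ_[p])) (faulhaber_comp_add_one hP)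
    simp only [derivative_comp, derivative_add, derivative_X, derivative_one, add_zero, one_mul,
      eval_comp, eval_add, eval_X, eval_one, derivative_X_pow, eval_mul, eval_pow, eval_C, ih] at this
    rw [sum_range_succ, Nat.cast_succ, this]
    ring

lemma sum_range_natCast_zmod {M : Type*} [AddCommMonoid M] (f : ZMod p → M) :
    ∑ k ∈ range p, f k = ∑ x, f x :=
  sum_nbij' (fun k => (k : ZMod p)) ZMod.val (by simp) (fun x _ => by simp [ZMod.val_lt])
    (fun k hk => ZMod.val_cast_of_lt (mem_range.1 hk)) (by simp) (by simp)

lemma sum_inv_mul_eval_zmod (h3 : 3 < p) {Q : (ZMod p)[X]} (hQ : Q.natDegree ≤ p - 2) :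
    ∑ x, x⁻¹ * Q.eval x = -Q.coeff 1 := by
  have hsum (j : ℕ) (hj : j ∈ range (p - 1)) :
      ∑ x : ZMod p, x⁻¹ * x ^ j = if j = 1 then -1 else 0 := by
    have hj := mem_range.1 hj
    split_ifs with h
    · subst h
      have (x : ZMod p) : x⁻¹ * x ^ 1 = 1 - if x = 0 then 1 else 0 := by
        split_ifs with hx <;> simp [hx]
      simp_rw [this]
      simp
    · rcases Nat.eq_zero_or_pos j with rfl | h0
      · have := FiniteField.sum_pow_lt_card_sub_one (ZMod p) 1 (by rw [ZMod.card]; omega)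
        rw [← Equiv.sum_comp (Equiv.inv (ZMod p))] at this
        simpa using this
      · have := FiniteField.sum_pow_lt_card_sub_one (ZMod p) (j - 1) (by rw [ZMod.card]; omega)
        rw [← this]
        refine sum_congr rfl fun x _ => ?_
        rcases eq_or_ne x 0 with rfl | hx
        · simp [show j - 1 ≠ 0 by omega]
        · rw [inv_mul_eq_iff_eq_mul₀ hx, ← pow_succ', Nat.sub_add_cancel h0]
  simp_rw [eval_eq_sum_range' (show Q.natDegree < p - 1 by omega), mul_sum]
  rw [sum_comm]
  simp_rw [mul_left_comm _ (Q.coeff _), ← mul_sum]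
  rw [sum_congr rfl fun j hj => by rw [hsum j hj]]
  rw [sum_eq_single_of_mem 1 (mem_range.2 (by omega)) fun j _ hj => by simp [hj]]
  simp

lemma dvd_eval_natCast_sub {P : ℤ_[p][X]} (h0 : P.coeff 0 = 0) :
    (p : ℤ_[p]) ^ 2 ∣ P.eval (p : ℤ_[p]) - p * P.coeff 1 := by
  have h := congrArg (eval (p : ℤ_[p])) (divX_mul_X_add P)
  have h' := congrArg (eval (p : ℤ_[p])) (divX_mul_X_add P.divX)
  simp only [eval_add, eval_mul, eval_X, eval_C, h0, coeff_divX, zero_add] at h h'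
  exact ⟨P.divX.divX.eval (p : ℤ_[p]), by linear_combination -h - p * h'⟩

/-- The sum of `i ^ (p-4)` over `0 < i < p / 2` is `-2 B_{p-3}` modulo `p`. -/
lemma toZMod_sum_pow_eq {m : ℕ} (hm : p = 2 * m + 1) (h3 : 3 < p) {P : ℤ_[p][X]}
    (h0 : P.coeff 0 = 0)
    (hP : ∀ n : ℕ, P.eval (n : ℤ_[p]) = ∑ i ∈ range n, (i : ℤ_[p]) ^ (p - 3)) :
    PadicInt.toZMod (∑ y ∈ range m, ((y + 1 : ℕ) : ℤ_[p]) ^ (p - 3 - 1)) =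
      -2 * PadicInt.toZMod (P.coeff 1) := by
  obtain ⟨h1, h2⟩ := dvd_sum_range_sub_of_reflect (R := ℤ_[p]) (m := m) (a := (p : ℤ_[p]) ^ 2)
    (f := fun i => (i : ℤ_[p]) ^ (p - 3)) (g := fun i => (i : ℤ_[p]) ^ (p - 3 - 1))
    (c := -((p - 3 : ℕ) : ℤ_[p]) * p) (lam := 2 ^ (p - 3)) (mu := 2 ^ (p - 3 - 1))
    (by simp; omega)
    (by
      intro i _ hi
      obtain ⟨k, hk⟩ := Polynomial.powAddExpansion (-(i : ℤ_[p])) p (p - 3)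
      rw [Even.neg_pow ⟨m - 1, by omega⟩, Odd.neg_pow ⟨m - 2, by omega⟩] at hk
      refine ⟨k, ?_⟩
      rw [← hm, Nat.cast_sub (by omega), show (p : ℤ_[p]) - i = -i + p by ring, hk]
      ring)
    (by intro i; push_cast; rw [mul_pow]) (by intro i; push_cast; rw [mul_pow])
  rw [← hm, ← hP] at h1 h2
  have hT := dvd_eval_natCast_sub h0
  set K := ∑ y ∈ range m, ((y + 1 : ℕ) : ℤ_[p]) ^ (p - 3 - 1)
  set h := ∑ y ∈ range m, ((y + 1 : ℕ) : ℤ_[p]) ^ (p - 3)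
  have hp0 : (p : ℤ_[p]) ≠ 0 := Nat.cast_ne_zero.2 hp.out.ne_zero
  have key : (p : ℤ_[p]) ∣ (2 ^ (p - 3) - 1) * P.coeff 1 +
      (2 ^ (p - 3) - 2 ^ (p - 3 - 1)) * ((p - 3 : ℕ) : ℤ_[p]) * K := by
    rw [← mul_dvd_mul_iff_left hp0, ← sq]
    convert ((h1.mul_left (2 ^ (p - 3))).sub h2).sub (hT.mul_left (2 ^ (p - 3) - 1)) using 1
    ring
  have h2p : (2 : ZMod p) ^ (p - 1) = 1 := by
    refine ZMod.pow_card_sub_one_eq_one ?_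
    exact_mod_cast (ZMod.natCast_eq_zero_iff 2 p).not.2 (Nat.not_dvd_of_pos_of_lt two_pos (by omega))
  have h3ne : (3 : ZMod p) ≠ 0 := by
    exact_mod_cast (ZMod.natCast_eq_zero_iff 3 p).not.2 (Nat.not_dvd_of_pos_of_lt three_pos h3)
  have hpow : (2 : ZMod p) ^ (p - 3) = 2 * 2 ^ (p - 3 - 1) := by
    rw [← pow_succ', Nat.sub_add_cancel (by omega)]
  have h8 : (8 : ZMod p) * 2 ^ (p - 3 - 1) = 1 := by
    rw [← h2p, show p - 1 = 3 + (p - 3 - 1) by omega, pow_add]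
    norm_num
  rw [← PadicInt.toZMod_eq_zero_iff] at key
  simp only [map_add, map_mul, map_sub, map_pow, map_one, map_ofNat, map_natCast] at key
  rw [Nat.cast_sub h3.le, CharP.cast_eq_zero, hpow] at key
  refine mul_left_cancel₀ h3ne ?_
  push_cast at key
  linear_combination -8 * key + (2 * PadicInt.toZMod (P.coeff 1) - 3 * PadicInt.toZMod K) * h8

/-- The harmonic sum of order two below `p / 2`, modulo `p²`. -/
lemma dvd_three_mul_harmonic_two_sub {m : ℕ} (hm : p = 2 * m + 1) (h3 : 3 < p) {P : ℤ_[p][X]}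
    (h0 : P.coeff 0 = 0)
    (hP : ∀ n : ℕ, P.eval (n : ℤ_[p]) = ∑ i ∈ range n, (i : ℤ_[p]) ^ (p - 3)) :
    (p : ℤ_[p]) ^ 2 ∣ 3 * ∑ y ∈ range m, Ring.inverse ((y + 1 : ℕ) : ℤ_[p]) ^ 2 -
      7 * (p * P.coeff 1) := by
  have hu2 : IsUnit (2 : ℤ_[p]) := by
    exact_mod_cast PadicInt.isUnit_natCast_of_lt (p := p) two_pos (by omega)
  have h22 := Ring.mul_inverse_cancel _ hu2
  obtain ⟨h1, h2⟩ := dvd_sum_range_sub_of_reflect (R := ℤ_[p]) (m := m) (a := (p : ℤ_[p]) ^ 2)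
    (f := fun i => Ring.inverse (i : ℤ_[p]) ^ 2) (g := fun i => Ring.inverse (i : ℤ_[p]) ^ 3)
    (c := 2 * (p : ℤ_[p])) (lam := Ring.inverse 2 ^ 2) (mu := Ring.inverse 2 ^ 3)
    (by simp)
    (by
      intro i h0i hi
      rw [← hm]
      have e1 := Ring.mul_inverse_cancel _ (PadicInt.isUnit_natCast_of_lt (p := p) h0i (hm ▸ hi))
      have e2 := Ring.mul_inverse_cancel _
        (PadicInt.isUnit_natCast_of_lt (p := p) (n := p - i) (by omega) (by omega))
      rw [Nat.cast_sub (by omega)] at e2 ⊢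
      set a := Ring.inverse ((p : ℤ_[p]) - i)
      set c := Ring.inverse (i : ℤ_[p])
      have e3 : a = -c + p * a * c := by linear_combination (-c) * e2 - a * e1
      exact ⟨a ^ 2 * c ^ 2 - 2 * a * c ^ 3,
        by linear_combination (a + (-c + p * a * c) - 2 * p * c ^ 2) * e3⟩)
    (by intro i; push_cast; rw [Ring.inverse_mul (.inl hu2), mul_comm, mul_pow])
    (by intro i; push_cast; rw [Ring.inverse_mul (.inl hu2), mul_comm, mul_pow])
  have hK : (p : ℤ_[p]) ∣
      ∑ y ∈ range m, Ring.inverse ((y + 1 : ℕ) : ℤ_[p]) ^ 3 + 2 * P.coeff 1 := by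
    rw [← PadicInt.toZMod_eq_zero_iff, map_add, map_mul, map_ofNat, ← sub_neg_eq_add, ← neg_mul,
      ← toZMod_sum_pow_eq hm h3 h0 hP, sub_eq_zero, map_sum, map_sum]
    refine sum_congr rfl fun y hy => ?_
    rw [map_pow, map_pow, PadicInt.toZMod_inverse, map_natCast]
    have hy := mem_range.1 hy
    have hne : ((y + 1 : ℕ) : ZMod p) ≠ 0 := (ZMod.natCast_eq_zero_iff _ p).not.2
      (Nat.not_dvd_of_pos_of_lt y.succ_pos (by omega))
    rw [inv_pow]
    refine inv_eq_of_mul_eq_one_right ?_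
    rw [← pow_add, show 3 + (p - 3 - 1) = p - 1 by omega, ZMod.pow_card_sub_one_eq_one hne]
  set K := ∑ y ∈ range m, Ring.inverse ((y + 1 : ℕ) : ℤ_[p]) ^ 3
  set h := ∑ y ∈ range m, Ring.inverse ((y + 1 : ℕ) : ℤ_[p]) ^ 2
  have hu4 : IsUnit (4 : ℤ_[p]) := by
    exact_mod_cast PadicInt.isUnit_natCast_of_lt (p := p) four_pos (by omega)
  refine hu4.dvd_mul_left.1 ?_
  obtain ⟨r, hr⟩ := hK
  obtain ⟨s, hs⟩ := h2.sub h1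
  set i2 := Ring.inverse (2 : ℤ_[p])
  have h4 : 4 * i2 ^ 2 = 1 := by linear_combination (2 * i2 + 1) * h22
  have h8 : 8 * i2 ^ 3 = 1 := by linear_combination 2 * i2 * h4 + h22
  exact ⟨8 * s - 14 * r, by linear_combination 8 * hs - 14 * p * hr + 4 * h * h4 + 2 * p * K * h8⟩

/-- The reflected sum of the odd reciprocals, modulo `p³`. -/
lemma dvd_two_mul_sum_inverse_odd_add {m : ℕ} (hm : p = 2 * m + 1) :
    (p : ℤ_[p]) ^ 3 ∣ 2 * ∑ k ∈ range p, Ring.inverse ((2 * k + 1 : ℕ) : ℤ_[p]) +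
      p * ∑ y ∈ range m, Ring.inverse ((y + 1 : ℕ) : ℤ_[p]) ^ 2 := by
  have hmid : Ring.inverse ((2 * m + 1 : ℕ) : ℤ_[p]) = 0 :=
    Ring.inverse_non_unit _ (by rw [← hm, PadicInt.isUnit_natCast_iff]; simp)
  rw [show range p = range (2 * m + 1) by rw [← hm], sum_range_two_mul_add_one_center, hmid,
    zero_add, mul_sum, mul_sum, ← sum_add_distrib]
  refine dvd_sum fun y hy => ?_
  have hy := mem_range.1 hy
  have e0 := Ring.mul_inverse_cancel _
    (PadicInt.isUnit_natCast_of_lt (p := p) (n := y + 1) (by omega) (by omega))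
  have e1 := Ring.mul_inverse_cancel _
    (PadicInt.isUnit_natCast_of_lt (p := p) (n := 2 * (m - (y + 1)) + 1) (by omega) (by omega))
  have e2 := Ring.mul_inverse_cancel _
    (PadicInt.isUnit_natCast_iff (p := p) (n := 2 * (m + (y + 1)) + 1).2 (by
      rw [show 2 * (m + (y + 1)) + 1 = p + 2 * (y + 1) by omega, Nat.dvd_add_right dvd_rfl]
      exact Nat.not_dvd_of_pos_of_lt (by omega) (by omega)))
  set a := Ring.inverse ((2 * (m - (y + 1)) + 1 : ℕ) : ℤ_[p])
  set b := Ring.inverse ((2 * (m + (y + 1)) + 1 : ℕ) : ℤ_[p])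
  set c := Ring.inverse ((y + 1 : ℕ) : ℤ_[p])
  have ha : ((2 * (m - (y + 1)) + 1 : ℕ) : ℤ_[p]) = p - 2 * (y + 1 : ℕ) := by
    rw [eq_sub_iff_add_eq]; exact_mod_cast (by omega)
  have hb : ((2 * (m + (y + 1)) + 1 : ℕ) : ℤ_[p]) = p + 2 * (y + 1 : ℕ) := by
    exact_mod_cast (by omega)
  rw [ha] at e1
  rw [hb] at e2
  generalize ((y + 1 : ℕ) : ℤ_[p]) = z at *
  have hab : a + b = 2 * p * (a * b) := by linear_combination -b * e1 - a * e2
  have hab' : a * b * (p ^ 2 - 4 * z ^ 2) = 1 := by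
    linear_combination (p + 2 * z) * b * e1 + e2
  have h4 : 4 * (a * b) = (p ^ 2 * (a * b) - 1) * c ^ 2 := by
    linear_combination -c ^ 2 * hab' - 4 * a * b * (z * c + 1) * e0
  exact ⟨a * b * c ^ 2, by linear_combination 2 * hab + p * h4⟩

/-- The double sum of odd reciprocals and harmonic numbers of order two, modulo `p`. -/
lemma dvd_two_mul_sum_inverse_odd_mul_harmonic_add {m : ℕ} (hm : p = 2 * m + 1) (h3 : 3 < p)
    {P : ℤ_[p][X]} (hdeg : P.natDegree ≤ p - 2) (h0 : P.coeff 0 = 0)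
    (hP : ∀ n : ℕ, P.eval (n : ℤ_[p]) = ∑ i ∈ range n, (i : ℤ_[p]) ^ (p - 3)) :
    (p : ℤ_[p]) ∣ 2 * ∑ k ∈ range p, Ring.inverse ((2 * k + 1 : ℕ) : ℤ_[p]) *
      ∑ j ∈ range k, Ring.inverse ((j + 1 : ℕ) : ℤ_[p]) ^ 2 + 7 * P.coeff 1 := by
  set G := P.map (PadicInt.toZMod (p := p)) with hGdef
  have h2 : (2 : ZMod p) ≠ 0 := by
    exact_mod_cast (ZMod.natCast_eq_zero_iff 2 p).not.2 (Nat.not_dvd_of_pos_of_lt two_pos (by omega))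
  have hG (k : ℕ) (hk : k ∈ range p) :
      ∑ j ∈ range k, (((j + 1 : ℕ) : ZMod p)⁻¹) ^ 2 = G.eval ((k : ZMod p) + 1) := by
    have := congrArg PadicInt.toZMod (hP (k + 1))
    rw [← Polynomial.eval_natCast_map, map_sum, sum_range_succ'] at this
    push_cast at this ⊢
    rw [hGdef, this]
    simp only [map_pow, map_add, map_natCast, map_one, map_zero]
    rw [zero_pow (by omega), add_zero]
    refine sum_congr rfl fun j hj => ?_
    have hj := mem_range.1 hj
    have hk := mem_range.1 hk
    have hne : ((j + 1 : ℕ) : ZMod p) ≠ 0 := (ZMod.natCast_eq_zero_iff _ p).not.2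
      (Nat.not_dvd_of_pos_of_lt j.succ_pos (by omega))
    rw [inv_pow]
    refine inv_eq_of_mul_eq_one_right ?_
    rw [← pow_add, show 2 + (p - 3) = p - 1 by omega]
    exact_mod_cast ZMod.pow_card_sub_one_eq_one hne
  set Q := G.comp (C 2⁻¹ * (X + 1)) with hQ
  have hQdeg : Q.natDegree ≤ p - 2 := by
    have h1 : (C (2 : ZMod p)⁻¹ * (X + 1)).natDegree ≤ 1 := by compute_degree
    calc Q.natDegree ≤ G.natDegree * (C (2 : ZMod p)⁻¹ * (X + 1)).natDegree := natDegree_comp_le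
      _ ≤ (p - 2) * 1 := Nat.mul_le_mul (natDegree_map_le.trans hdeg) h1
      _ = p - 2 := mul_one _
  have hS : PadicInt.toZMod (∑ k ∈ range p, Ring.inverse ((2 * k + 1 : ℕ) : ℤ_[p]) *
      ∑ j ∈ range k, Ring.inverse ((j + 1 : ℕ) : ℤ_[p]) ^ 2) = -Q.coeff 1 := by
    rw [← sum_inv_mul_eval_zmod h3 hQdeg, ← Equiv.sum_comp
      ((Equiv.mulLeft₀ (2 : ZMod p) h2).trans (Equiv.addRight 1)),
      ← sum_range_natCast_zmod (p := p), map_sum]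
    refine sum_congr rfl fun k hk => ?_
    rw [map_mul, PadicInt.toZMod_inverse, map_sum]
    simp_rw [map_pow, PadicInt.toZMod_inverse, map_natCast]
    rw [hG k hk]
    have : (2 : ZMod p)⁻¹ * (2 * k + 1 + 1) = k + 1 := by field_simp; ring
    simp [hQ, eval_comp, this]
  have hhalf : (2 : ZMod p)⁻¹ = ((m + 1 : ℕ) : ZMod p) := by
    refine inv_eq_of_mul_eq_one_right ?_
    have := congrArg (Nat.cast (R := ZMod p)) hm
    rw [CharP.cast_eq_zero] at this
    push_cast at this ⊢
    linear_combination -this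
  have hcoeff : 2 * Q.coeff 1 = PadicInt.toZMod ((derivative P).eval ((m + 1 : ℕ) : ℤ_[p])) := by
    have h1 : Q.coeff 1 = (derivative Q).eval 0 := by
      rw [← coeff_zero_eq_eval_zero, coeff_derivative]; simp
    rw [h1, hQ, derivative_comp, ← Polynomial.eval_natCast_map, ← derivative_map, ← hhalf]
    simp [eval_comp, h2, hGdef, derivative_map]
  rw [eval_derivative_faulhaber hP, sum_range_succ', Nat.cast_zero, zero_pow (by omega), add_zero,
    map_add, map_mul, toZMod_sum_pow_eq hm h3 h0 hP, map_natCast, Nat.cast_sub h3.le,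
    CharP.cast_eq_zero] at hcoeff
  rw [← PadicInt.toZMod_eq_zero_iff, map_add, map_mul, map_mul, hS]
  simp only [map_ofNat]
  push_cast at hcoeff
  linear_combination -hcoeff

lemma dvd_prod_one_sub_sq_sub (k : ℕ) :
    (p : ℤ_[p]) ^ 4 ∣
      (∏ j ∈ range k, (1 - (p : ℤ_[p]) ^ 2 * Ring.inverse ((j + 1 : ℕ) : ℤ_[p]) ^ 2)) ^ 2 -
        (1 - 2 * p ^ 2 * ∑ j ∈ range k, Ring.inverse ((j + 1 : ℕ) : ℤ_[p]) ^ 2) := by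
  induction k with
  | zero => simp
  | succ k ih =>
    obtain ⟨r, hr⟩ := ih
    rw [prod_range_succ, sum_range_succ]
    set c := Ring.inverse ((k + 1 : ℕ) : ℤ_[p])
    set H := ∑ j ∈ range k, Ring.inverse ((j + 1 : ℕ) : ℤ_[p]) ^ 2
    exact ⟨4 * H * c ^ 2 + c ^ 4 * (1 - 2 * p ^ 2 * H) + r * (1 - p ^ 2 * c ^ 2) ^ 2,
      by linear_combination (1 - (p : ℤ_[p]) ^ 2 * c ^ 2) ^ 2 * hr⟩

lemma sum_aperyNum_eq_padicInt {m : ℕ} (hm : p = 2 * m + 1) :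
    ((∑ k ∈ range p, (2 * (k : ℤ) + 1) * aperyNum k : ℤ) : ℤ_[p]) =
      p ^ 2 * ∑ k ∈ range p, Ring.inverse ((2 * k + 1 : ℕ) : ℤ_[p]) *
        (∏ j ∈ range k, (1 - (p : ℤ_[p]) ^ 2 * Ring.inverse ((j + 1 : ℕ) : ℤ_[p]) ^ 2)) ^ 2 +
      p * (∏ j ∈ range m, (1 - (p : ℤ_[p]) ^ 2 * Ring.inverse ((j + 1 : ℕ) : ℤ_[p]) ^ 2)) ^ 2 := by
  set q : ℕ → ℤ_[p] := fun k =>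
    ∏ j ∈ range k, (1 - (p : ℤ_[p]) ^ 2 * Ring.inverse ((j + 1 : ℕ) : ℤ_[p]) ^ 2)
  have hp0 : (p : ℚ_[p]) ≠ 0 := Nat.cast_ne_zero.2 hp.out.ne_zero
  have hprod (k : ℕ) (hk : k ∈ range p) :
      (∏ j ∈ range k, ((p : ℚ_[p]) ^ 2 - (j + 1) ^ 2) / (j + 1) ^ 2) ^ 2 = (q k : ℚ_[p]) ^ 2 := by
    have hcoe : (q k : ℚ_[p]) = ∏ j ∈ range k,
        ((1 - (p : ℤ_[p]) ^ 2 * Ring.inverse ((j + 1 : ℕ) : ℤ_[p]) ^ 2 : ℤ_[p]) : ℚ_[p]) :=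
      map_prod PadicInt.Coe.ringHom _ _
    rw [hcoe, ← prod_pow, ← prod_pow]
    refine prod_congr rfl fun j hj => ?_
    have hj := mem_range.1 hj
    have hk := mem_range.1 hk
    have hu := PadicInt.isUnit_natCast_of_lt (p := p) (n := j + 1) (by omega) (by omega)
    have hj0 : ((j : ℚ_[p]) + 1) ≠ 0 := j.cast_add_one_ne_zero
    push_cast at hu ⊢
    rw [PadicInt.coe_inverse hu]
    push_cast
    field_simp
    ring
  have hmid : (p : ℤ_[p]) * q m ^ 2 = ∑ k ∈ range p, if k = m then (p : ℤ_[p]) * q k ^ 2 else 0 := by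
    rw [sum_ite_eq', if_pos (mem_range.2 (by omega))]
  change _ = (p : ℤ_[p]) ^ 2 * ∑ k ∈ range p, _ * q k ^ 2 + p * q m ^ 2
  rw [hmid, mul_sum, ← sum_add_distrib]
  refine PadicInt.ext ?_
  rw [PadicInt.coe_intCast, sum_two_mul_add_one_mul_aperyNum, PadicInt.coe_sum]
  refine sum_congr rfl fun k hk => ?_
  rw [hprod k hk]
  split_ifs with hkm
  · have hk' : (2 * (k : ℚ_[p]) + 1) = p := by
      rw [hkm]; exact_mod_cast hm.symm
    rw [hkm, ← hm, Ring.inverse_non_unit _ (by rw [PadicInt.isUnit_natCast_iff]; simp), ← hkm, hk']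
    push_cast
    field_simp
    ring
  · have hu : IsUnit ((2 * k + 1 : ℕ) : ℤ_[p]) := PadicInt.isUnit_natCast_iff.2 fun ⟨c, hc⟩ => by
      have hk := mem_range.1 hk
      have hc2 : c < 2 := by
        by_contra! h
        have := Nat.mul_le_mul_left p h
        omega
      interval_cases c <;> omega
    rw [PadicInt.coe_add, PadicInt.coe_mul, PadicInt.coe_mul, PadicInt.coe_inverse hu,
      PadicInt.coe_natCast]
    push_cast
    ring

end Padic

end

/-- For a prime `p > 3`,
`∑_{k=0}^{p-1} (2k+1) A_k ≡ p + (7/6) p⁴ B_{p-3} (mod p⁵)`,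
i.e. the difference is `p⁵` times a `p`-adic integer. -/
theorem sum_two_k_add_one_apery_num (p : ℕ) [Fact p.Prime] (h3 : 3 < p) :
    ∃ z : ℤ_[p],
      ((∑ k ∈ Finset.range p, (2 * (k : ℤ) + 1) * aperyNum k : ℤ) : ℚ_[p]) -
        (p : ℚ_[p]) - 7 / 6 * (p : ℚ_[p]) ^ 4 * (bernoulli (p - 3) : ℚ_[p]) =
      (p : ℚ_[p]) ^ 5 * z := by
  have hp : p.Prime := Fact.out
  obtain ⟨m, hm⟩ := hp.odd_of_ne_two (by omega)
  obtain ⟨P, hdeg, h0, hb, hP⟩ := exists_faulhaber_polynomial (p := p) (e := p - 3) (by omega)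
  obtain ⟨w, hw⟩ := dvd_two_mul_sum_inverse_odd_add hm
  obtain ⟨x, hx⟩ := dvd_three_mul_harmonic_two_sub hm h3 h0 hP
  obtain ⟨y, hy⟩ :=
    dvd_two_mul_sum_inverse_odd_mul_harmonic_add hm h3 (hdeg.trans (by omega)) h0 hP
  obtain ⟨v, hv⟩ := dvd_prod_one_sub_sq_sub (p := p) m
  choose r hr using dvd_prod_one_sub_sq_sub (p := p)
  have hN := sum_aperyNum_eq_padicInt hm
  have hsum : ∑ k ∈ Finset.range p, Ring.inverse ((2 * k + 1 : ℕ) : ℤ_[p]) *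
        (∏ j ∈ Finset.range k,
          (1 - (p : ℤ_[p]) ^ 2 * Ring.inverse ((j + 1 : ℕ) : ℤ_[p]) ^ 2)) ^ 2 =
      ∑ k ∈ Finset.range p, Ring.inverse ((2 * k + 1 : ℕ) : ℤ_[p]) -
        2 * p ^ 2 * ∑ k ∈ Finset.range p, Ring.inverse ((2 * k + 1 : ℕ) : ℤ_[p]) *
          ∑ j ∈ Finset.range k, Ring.inverse ((j + 1 : ℕ) : ℤ_[p]) ^ 2 +
        p ^ 4 * ∑ k ∈ Finset.range p, Ring.inverse ((2 * k + 1 : ℕ) : ℤ_[p]) * r k := by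
    rw [Finset.mul_sum, Finset.mul_sum, ← Finset.sum_sub_distrib, ← Finset.sum_add_distrib]
    refine Finset.sum_congr rfl fun k _ => ?_
    rw [eq_add_of_sub_eq (hr k)]
    ring
  rw [hsum] at hN
  have hu : IsUnit ((6 : ℕ) : ℤ_[p]) := PadicInt.isUnit_natCast_iff.2 fun h => by
    rcases (hp.dvd_mul (m := 2) (n := 3)).1 h with h | h <;>
      exact absurd (Nat.le_of_dvd (by norm_num) h) (by omega)
  have hdvd : ((6 : ℕ) : ℤ_[p]) * (((∑ k ∈ Finset.range p, (2 * (k : ℤ) + 1) * aperyNum k : ℤ) :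
      ℤ_[p]) - p) - (7 : ℕ) * p ^ 4 * P.coeff 1 = p ^ 5 * (6 * p * ∑ k ∈ Finset.range p,
        Ring.inverse ((2 * k + 1 : ℕ) : ℤ_[p]) * r k + 6 * v + 3 * w - 5 * x - 6 * y) := by
    push_cast at *
    linear_combination 6 * hN + 6 * p * hv + 3 * p ^ 2 * hw - 5 * p ^ 3 * hx - 6 * p ^ 4 * hy
  have hcoe := congrArg (fun z : ℤ_[p] => (z : ℚ_[p])) hdvd
  refine ⟨Ring.inverse ((6 : ℕ) : ℤ_[p]) * (6 * p * ∑ k ∈ Finset.range p,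
        Ring.inverse ((2 * k + 1 : ℕ) : ℤ_[p]) * r k + 6 * v + 3 * w - 5 * x - 6 * y), ?_⟩
  rw [PadicInt.coe_mul, PadicInt.coe_inverse hu, mul_left_comm, eq_inv_mul_iff_mul_eq₀
    (by simp), ← hb]
  simp only [PadicInt.coe_mul, PadicInt.coe_sub, PadicInt.coe_pow, PadicInt.coe_natCast,
    PadicInt.coe_intCast] at hcoe ⊢
  rw [← hcoe]
  push_cast
  ring
end

section
/- Let ε ∈ {1, -1} and let m be a positive integer. Then for any prime p we have ∑_{k=0}^{p-1} (2k+1) ε^k A_k^m ≡ 0 (mod p). -/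
/-- In a commutative ring, `C(n,k) C(n+k,k) k!²` is a polynomial in `n (n + 1)`. -/
theorem choose_mul_choose_mul_factorial_sq {R : Type*} [CommRing R] (n k : ℕ) :
    (n.choose k : R) * ((n + k).choose k : R) * (k.factorial : R) ^ 2 =
      ∏ j ∈ Finset.range k, ((n : R) * (n + 1) - j * (j + 1)) := by
  induction k with
  | zero => simp
  | succ k ih =>
    rw [Finset.prod_range_succ, ← ih, Nat.factorial_succ]
    have h₁ : (n.choose (k + 1) : R) * (k + 1) = n.choose k * (n - k) := by
      rcases le_or_gt k n with h | h
      · have := congrArg (Nat.cast : ℕ → R) (Nat.choose_succ_right_eq n k)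
        push_cast [Nat.cast_sub h] at this
        exact this
      · simp [Nat.choose_eq_zero_of_lt h, Nat.choose_eq_zero_of_lt (Nat.lt_succ_of_lt h)]
    have h₂ : ((n + (k + 1)).choose (k + 1) : R) * (k + 1) =
        (n + k + 1) * (n + k).choose k := by
      have := congrArg (Nat.cast : ℕ → R) (Nat.add_one_mul_choose_eq (n + k) k)
      push_cast at this
      exact this.symm
    push_cast
    linear_combination (k.factorial : R) ^ 2 * ((n + (k + 1)).choose (k + 1) * (k + 1)) * h₁ +
      (k.factorial : R) ^ 2 * (n.choose k * (n - k)) * h₂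

theorem aperyNum_eq_sum_range {n N : ℕ} (h : n < N) :
    aperyNum n =
      ∑ k ∈ Finset.range N, (n.choose k : ℤ) ^ 2 * ((n + k).choose k : ℤ) ^ 2 := by
  refine Finset.sum_subset (Finset.range_subset_range.2 h) fun k _ hk => ?_
  rw [Nat.choose_eq_zero_of_lt (by rw [Finset.mem_range] at hk; omega)]
  simp

/-- Modulo a prime `p`, the Apéry numbers satisfy `A_n ≡ A_{p-1-n}`. -/
theorem aperyNum_cast_eq_of_add_add_one_eq {p a b : ℕ} [Fact p.Prime] (h : a + b + 1 = p) :
    (aperyNum a : ZMod p) = aperyNum b := by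
  rw [aperyNum_eq_sum_range (N := p) (by omega), aperyNum_eq_sum_range (N := p) (by omega)]
  push_cast
  refine Finset.sum_congr rfl fun k hk => ?_
  have hk_fact : (k.factorial : ZMod p) ^ 2 ≠ 0 := by
    refine pow_ne_zero _ fun h0 => ?_
    rw [ZMod.natCast_eq_zero_iff, (Fact.out : p.Prime).dvd_factorial] at h0
    exact absurd (Finset.mem_range.1 hk) (not_lt.2 h0)
  have hab : (a : ZMod p) + b + 1 = 0 := by
    have := congrArg (Nat.cast : ℕ → ZMod p) h
    push_cast at this
    simpa using this
  rw [← mul_pow, ← mul_pow]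
  congr 1
  apply mul_right_cancel₀ hk_fact
  rw [choose_mul_choose_mul_factorial_sq, choose_mul_choose_mul_factorial_sq]
  refine Finset.prod_congr rfl fun j _ => ?_
  linear_combination ((a : ZMod p) - b) * hab

/-- For `ε ∈ {1,-1}`, a positive integer `m` and any prime `p`,
`∑_{k=0}^{p-1} (2k+1) ε^k A_k^m ≡ 0 (mod p)`. -/
theorem sum_two_k_add_one_apery_pow (p : ℕ) (hp : p.Prime) (ε : ℤ) (hε : ε = 1 ∨ ε = -1)
    (m : ℕ) (hm : 0 < m) :
    (p : ℤ) ∣ ∑ k ∈ Finset.range p, (2 * (k : ℤ) + 1) * ε ^ k * aperyNum k ^ m := by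
  have : Fact p.Prime := ⟨hp⟩
  rw [← ZMod.intCast_zmod_eq_zero_iff_dvd]
  rcases hp.eq_two_or_odd' with rfl | hodd
  · have h01 := aperyNum_cast_eq_of_add_add_one_eq (p := 2) (a := 0) (b := 1) rfl
    have h0 : aperyNum 0 = 1 := by simp [aperyNum]
    have hε' : (ε : ZMod 2) = 1 := by rcases hε with rfl | rfl <;> rfl
    push_cast [Finset.sum_range_succ, Finset.sum_range_zero, ← h01, h0, hε']
    simp
    rfl
  · push_cast
    set f : ℕ → ZMod p := fun k => (2 * (k : ZMod p) + 1) * (ε : ZMod p) ^ k * aperyNum k ^ m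
    have hf : ∀ k ∈ Finset.range p, f (p - 1 - k) = -f k := by
      intro k hk
      have hsum : k + (p - 1 - k) + 1 = p := by have := Finset.mem_range.1 hk; omega
      generalize p - 1 - k = b at hsum
      have hkb : (k : ZMod p) + b + 1 = 0 := by
        have := congrArg (Nat.cast : ℕ → ZMod p) hsum
        push_cast at this
        simpa using this
      have hpow : (ε : ZMod p) ^ b = (ε : ZMod p) ^ k := by
        rcases hε with rfl | rfl
        · simp
        · have hpar : Even b ↔ Even k := by
            rw [← hsum] at hodd
            grind
          push_cast
          rcases Nat.even_or_odd k with he | ho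
          · rw [he.neg_one_pow, (hpar.2 he).neg_one_pow]
          · rw [ho.neg_one_pow, Odd.neg_one_pow]
            rw [← Nat.not_even_iff_odd] at ho ⊢
            exact fun h => ho (hpar.1 h)
      simp only [f]
      rw [hpow, ← aperyNum_cast_eq_of_add_add_one_eq hsum]
      linear_combination 2 * (ε : ZMod p) ^ k * (aperyNum k : ZMod p) ^ m * hkb
    have hS : ∑ k ∈ Finset.range p, f k = -∑ k ∈ Finset.range p, f k := by
      rw [← Finset.sum_neg_distrib, ← Finset.sum_range_reflect f p]
      exact Finset.sum_congr rfl hf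
    have h2 : (2 : ZMod p) ≠ 0 :=
      Ring.two_ne_zero (by rw [ZMod.ringChar_zmod_n]; rintro rfl; exact absurd hodd (by decide))
    refine (mul_eq_zero.1 (?_ : (2 : ZMod p) * _ = 0)).resolve_left h2
    linear_combination hS
end
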